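/- arXiv:2504.08105 — 3 statements merged into one kernel-verified Lean document; each statement's English description precedes it below -/
import Mathlib

section
/- Let 0 ≤ τ < σ ≤ ∞ and m ≥ 1, and let f : (τ,σ) → ℝ^m be a six-times continuously differentiable function such that the radial function u(x) = f(|x|) satisfies Δ³u = 0 on the open annulus {x ∈ ℝ⁴ : τ < |x| < σ}. Then there exist vectors A₁, …, A₆ ∈ ℝ^m such that f(r) = A₁ r^{-2} + A₂ + A₃ ln r + A₄ r² + A₅ r² ln r + A₆ r⁴ for all r ∈ (τ,σ). -/
noncomputable section

/-- The Euclidean Laplacian on `ℝ⁴`, `Δu = Σ_{i=1}^4 ∂²u/∂x_i²`, applied componentwise to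
vector-valued functions. -/
def lap {V : Type*} [NormedAddCommGroup V] [NormedSpace ℝ V]
    (u : EuclideanSpace ℝ (Fin 4) → V) (x : EuclideanSpace ℝ (Fin 4)) : V :=
  ∑ i : Fin 4,
    fderiv ℝ (fun y => fderiv ℝ u y (EuclideanSpace.single i 1)) x (EuclideanSpace.single i 1)

/-- The radial part `g'' + (3 / r) g'` of the Laplacian on `ℝ⁴`. -/
def radialLap {V : Type*} [NormedAddCommGroup V] [NormedSpace ℝ V] (g : ℝ → V) (r : ℝ) : V :=
  deriv (deriv g) r + (3 / r) • deriv g r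

section

variable {V : Type*} [NormedAddCommGroup V] [NormedSpace ℝ V]

theorem lap_congr {u v : EuclideanSpace ℝ (Fin 4) → V} {x : EuclideanSpace ℝ (Fin 4)}
    (h : u =ᶠ[nhds x] v) : lap u x = lap v x := by
  unfold lap
  refine Finset.sum_congr rfl fun i _ => ?_
  have h' : (fun y => fderiv ℝ u y (EuclideanSpace.single i 1)) =ᶠ[nhds x]
      fun y => fderiv ℝ v y (EuclideanSpace.single i 1) := by
    filter_upwards [h.fderiv (𝕜 := ℝ)] with y hy
    rw [hy]
  rw [h'.fderiv_eq]

theorem hasFDerivAt_norm_euclidean {x : EuclideanSpace ℝ (Fin 4)} (hx : x ≠ 0) :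
    HasFDerivAt (fun y : EuclideanSpace ℝ (Fin 4) => ‖y‖) (‖x‖⁻¹ • innerSL ℝ x) x := by
  have hx' : ‖x‖ ≠ 0 := norm_ne_zero_iff.mpr hx
  have h := ((hasStrictFDerivAt_norm_sq x).hasFDerivAt).sqrt (by positivity)
  have e : (fun y : EuclideanSpace ℝ (Fin 4) => √(‖y‖ ^ 2)) = fun y => ‖y‖ := by
    funext y
    exact Real.sqrt_sq (norm_nonneg y)
  rw [e, Real.sqrt_sq (norm_nonneg x)] at h
  refine h.congr_fderiv ?_
  ext v
  simp only [smul_apply, nsmul_eq_mul, smul_eq_mul, Nat.cast_ofNat]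
  field_simp

theorem lap_radial {I : Set ℝ} (hI : IsOpen I) (hpos : ∀ r ∈ I, 0 < r) {g : ℝ → V}
    (hg : ContDiffOn ℝ 2 g I) {x : EuclideanSpace ℝ (Fin 4)} (hx : ‖x‖ ∈ I) :
    lap (fun y => g ‖y‖) x = radialLap g ‖x‖ := by
  have hd1 : ∀ r ∈ I, HasDerivAt g (deriv g r) r := fun r hr =>
    ((hg.differentiableOn (by norm_num)).differentiableAt (hI.mem_nhds hr)).hasDerivAt
  have hg' : ContDiffOn ℝ 1 (deriv g) I := hg.deriv_of_isOpen hI (by norm_num)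
  have hd2 : ∀ r ∈ I, HasDerivAt (deriv g) (deriv (deriv g) r) r := fun r hr =>
    ((hg'.differentiableOn (by norm_num)).differentiableAt (hI.mem_nhds hr)).hasDerivAt
  have hne : ∀ y : EuclideanSpace ℝ (Fin 4), ‖y‖ ∈ I → y ≠ 0 := fun y hy =>
    norm_pos_iff.mp (hpos _ hy)
  have hnhds : ∀ᶠ y in nhds x, ‖y‖ ∈ I := continuous_norm.continuousAt (hI.mem_nhds hx)
  have hfirst (i : Fin 4) :
      (fun y => fderiv ℝ (fun y => g ‖y‖) y (EuclideanSpace.single i 1)) =ᶠ[nhds x]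
        fun y => (‖y‖⁻¹ * y i) • deriv g ‖y‖ := by
    filter_upwards [hnhds] with y hy
    have h := (hd1 _ hy).hasFDerivAt.comp y (hasFDerivAt_norm_euclidean (hne y hy))
    have h2 := h.fderiv
    simp only [Function.comp_def] at h2
    rw [h2]
    simp [EuclideanSpace.inner_single_right, smul_smul]
  have hr := hpos _ hx
  have hsecond (i : Fin 4) :
      fderiv ℝ (fun y => fderiv ℝ (fun y => g ‖y‖) y (EuclideanSpace.single i 1)) x
        (EuclideanSpace.single i 1) =
      (x i ^ 2 * (‖x‖ ^ 2)⁻¹) • deriv (deriv g) ‖x‖ +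
        (‖x‖⁻¹ - x i ^ 2 * (‖x‖ ^ 3)⁻¹) • deriv g ‖x‖ := by
    rw [(hfirst i).fderiv_eq]
    have hn := hasFDerivAt_norm_euclidean (hne x hx)
    have hinv := (hasDerivAt_inv hr.ne').hasFDerivAt.comp x hn
    have hcoord : HasFDerivAt (fun y : EuclideanSpace ℝ (Fin 4) => y i)
        (EuclideanSpace.proj (𝕜 := ℝ) i : EuclideanSpace ℝ (Fin 4) →L[ℝ] ℝ) x :=
      (EuclideanSpace.proj i : EuclideanSpace ℝ (Fin 4) →L[ℝ] ℝ).hasFDerivAt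
    have h := (hinv.mul hcoord).smul ((hd2 _ hx).hasFDerivAt.comp x hn)
    have h2 := h.fderiv
    simp only [Function.comp_def] at h2
    have h3 := congrArg (fun l => l (EuclideanSpace.single i (1 : ℝ))) h2
    refine Eq.trans h3 ?_
    simp [EuclideanSpace.inner_single_right, smul_smul]
    congr 2
    · field_simp
    · field_simp
      ring
  unfold lap radialLap
  rw [Finset.sum_congr rfl fun i _ => hsecond i, Finset.sum_add_distrib, ← Finset.sum_smul,
    ← Finset.sum_smul, Finset.sum_sub_distrib, ← Finset.sum_mul, ← Finset.sum_mul,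
    ← EuclideanSpace.real_norm_sq_eq]
  congr 2
  · rw [mul_inv_cancel₀ (by positivity), one_smul]
  · simp
    field_simp
    norm_num

theorem contDiffOn_radialLap {I : Set ℝ} (hI : IsOpen I) (hpos : ∀ r ∈ I, 0 < r) {g : ℝ → V}
    {n : ℕ} (hg : ContDiffOn ℝ (n + 2 : ℕ) g I) : ContDiffOn ℝ n (radialLap g) I := by
  have h1 : ContDiffOn ℝ (n + 1 : ℕ) (deriv g) I := hg.deriv_of_isOpen hI (by norm_cast)
  have h2 : ContDiffOn ℝ n (deriv (deriv g)) I := h1.deriv_of_isOpen hI (by norm_cast)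
  exact h2.add ((contDiffOn_const.div contDiffOn_id fun r hr => (hpos r hr).ne').smul
    (h1.of_le (by norm_cast; omega)))

theorem exists_eq_add_const {I : Set ℝ} (hI : IsOpen I) (hI' : IsPreconnected I) {g h g' : ℝ → V}
    (hg : ∀ r ∈ I, HasDerivAt g (g' r) r) (hh : ∀ r ∈ I, HasDerivAt h (g' r) r) :
    ∃ c, ∀ r ∈ I, g r = h r + c := by
  have hd : ∀ r ∈ I, HasDerivAt (fun r => g r - h r) 0 r := fun r hr => by
    exact ((hg r hr).sub (hh r hr)).congr_deriv (sub_self _)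
  obtain ⟨c, hc⟩ := hI.exists_is_const_of_deriv_eq_zero hI'
    (fun r hr => (hd r hr).differentiableAt.differentiableWithinAt) (fun r hr => (hd r hr).deriv)
  exact ⟨c, fun r hr => by rw [← hc r hr]; abel⟩

/-- The solutions of `g'' + (3 / r) g' = r⁻² a + b + (ln r) c + r² d`. -/
theorem exists_of_radialLap_eq {I : Set ℝ} (hI : IsOpen I) (hI' : IsPreconnected I)
    (hpos : ∀ r ∈ I, 0 < r) {g : ℝ → V} (hg : ContDiffOn ℝ 2 g I) {a b c d : V}
    (h : ∀ r ∈ I, radialLap g r = (r ^ 2)⁻¹ • a + b + Real.log r • c + r ^ 2 • d) :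
    ∃ p q : V, ∀ r ∈ I, g r = (r ^ 2)⁻¹ • p + q + Real.log r • ((1 / 2 : ℝ) • a) +
      r ^ 2 • ((1 / 8 : ℝ) • b - (3 / 32 : ℝ) • c) + (r ^ 2 * Real.log r) • ((1 / 8 : ℝ) • c) +
      r ^ 4 • ((1 / 24 : ℝ) • d) := by
  have hd1 : ∀ r ∈ I, HasDerivAt g (deriv g r) r := fun r hr =>
    ((hg.differentiableOn (by norm_num)).differentiableAt (hI.mem_nhds hr)).hasDerivAt
  have hg' : ContDiffOn ℝ 1 (deriv g) I := hg.deriv_of_isOpen hI (by norm_num)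
  have hd2 : ∀ r ∈ I, HasDerivAt (deriv g) (deriv (deriv g) r) r := fun r hr =>
    ((hg'.differentiableOn (by norm_num)).differentiableAt (hI.mem_nhds hr)).hasDerivAt
  have hpow (n : ℕ) (r : ℝ) := hasDerivAt_pow (𝕜 := ℝ) n r
  obtain ⟨k, hk⟩ := exists_eq_add_const hI hI' (g := fun r => r ^ 3 • deriv g r)
    (h := fun r => (r ^ 2 / 2) • a + (r ^ 4 / 4) • b + (r ^ 4 / 4 * Real.log r - r ^ 4 / 16) • c +
      (r ^ 6 / 6) • d) (g' := fun r => r ^ 3 • radialLap g r)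
    (fun r hr => by
      have hr0 := (hpos r hr).ne'
      refine ((hpow 3 r).smul (hd2 r hr)).congr_deriv ?_
      simp only [radialLap, smul_add, smul_smul]
      congr 2
      field_simp
      norm_num [mul_comm])
    (fun r hr => by
      have hr0 := (hpos r hr).ne'
      have hl := Real.hasDerivAt_log hr0
      refine ((((((hpow 2 r).div_const 2).smul_const a).add
        (((hpow 4 r).div_const 4).smul_const b)).add
        (((((hpow 4 r).div_const 4).mul hl).sub ((hpow 4 r).div_const 16)).smul_const c)).add
        (((hpow 6 r).div_const 6).smul_const d)).congr_deriv ?_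
      rw [h r hr]
      match_scalars <;> field_simp <;> ring)
  have hk' : ∀ r ∈ I, deriv g r = (r ^ 3)⁻¹ • ((r ^ 2 / 2) • a + (r ^ 4 / 4) • b +
      (r ^ 4 / 4 * Real.log r - r ^ 4 / 16) • c + (r ^ 6 / 6) • d + k) := fun r hr => by
    rw [← hk r hr, smul_smul, inv_mul_cancel₀ (pow_ne_zero 3 (hpos r hr).ne'), one_smul]
  obtain ⟨q, hq⟩ := exists_eq_add_const hI hI' (g := g)
    (h := fun r => (r ^ 2)⁻¹ • ((-1 / 2 : ℝ) • k) + Real.log r • ((1 / 2 : ℝ) • a) +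
      r ^ 2 • ((1 / 8 : ℝ) • b - (3 / 32 : ℝ) • c) + (r ^ 2 * Real.log r) • ((1 / 8 : ℝ) • c) +
      r ^ 4 • ((1 / 24 : ℝ) • d)) hd1
    (fun r hr => by
      have hr0 := (hpos r hr).ne'
      have hl := Real.hasDerivAt_log hr0
      refine ((((((hpow 2 r).inv (pow_ne_zero 2 hr0)).smul_const _).add (hl.smul_const _)).add
        ((hpow 2 r).smul_const _)).add (((hpow 2 r).mul hl).smul_const _)).add
        ((hpow 4 r).smul_const _) |>.congr_deriv ?_
      rw [hk' r hr]
      match_scalars <;> field_simp <;> ring)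
  exact ⟨(-1 / 2 : ℝ) • k, q, fun r hr => by rw [hq r hr]; abel⟩

end

/-- a radial triharmonic function on an annulus in `ℝ⁴` (possibly with outer
radius `∞`) has radial profile `A₁ r⁻² + A₂ + A₃ ln r + A₄ r² + A₅ r² ln r + A₆ r⁴`. -/
theorem stmt0 (m : ℕ) (hm : 1 ≤ m) (τ : ℝ) (σ : EReal) (hτ : 0 ≤ τ) (hτσ : (τ : EReal) < σ)
    (f : ℝ → EuclideanSpace ℝ (Fin m))
    (hf : ContDiffOn ℝ 6 f {r : ℝ | τ < r ∧ (r : EReal) < σ})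
    (hu : ∀ x : EuclideanSpace ℝ (Fin 4), τ < ‖x‖ → (‖x‖ : EReal) < σ →
      lap (lap (lap (fun y => f ‖y‖))) x = 0) :
    ∃ A : Fin 6 → EuclideanSpace ℝ (Fin m), ∀ r : ℝ, τ < r → (r : EReal) < σ →
      f r = (r ^ 2)⁻¹ • A 0 + A 1 + Real.log r • A 2 + r ^ 2 • A 3 +
        (r ^ 2 * Real.log r) • A 4 + r ^ 4 • A 5 := by
  set I : Set ℝ := {r : ℝ | τ < r ∧ (r : EReal) < σ} with hIdef
  have hI : IsOpen I :=
    (isOpen_lt continuous_const continuous_id).inter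
      (isOpen_lt continuous_coe_real_ereal continuous_const)
  have hI' : IsPreconnected I := by
    refine Set.OrdConnected.isPreconnected ⟨fun a ha b hb c hc => ?_⟩
    exact ⟨ha.1.trans_le hc.1, (EReal.coe_le_coe_iff.mpr hc.2).trans_lt hb.2⟩
  have hpos : ∀ r ∈ I, 0 < r := fun r hr => hτ.trans_lt hr.1
  have hf1 : ContDiffOn ℝ 4 (radialLap f) I := contDiffOn_radialLap hI hpos (n := 4) hf
  have hf2 : ContDiffOn ℝ 2 (radialLap (radialLap f)) I :=
    contDiffOn_radialLap hI hpos (n := 2) hf1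
  have hnhds {x : EuclideanSpace ℝ (Fin 4)} (hx : ‖x‖ ∈ I) : ∀ᶠ y in nhds x, ‖y‖ ∈ I :=
    continuous_norm.continuousAt (hI.mem_nhds hx)
  have hl1 {x : EuclideanSpace ℝ (Fin 4)} (hx : ‖x‖ ∈ I) :
      lap (fun y => f ‖y‖) x = radialLap f ‖x‖ :=
    lap_radial hI hpos (hf.of_le (by norm_num)) hx
  have hl2 {x : EuclideanSpace ℝ (Fin 4)} (hx : ‖x‖ ∈ I) :
      lap (lap (fun y => f ‖y‖)) x = radialLap (radialLap f) ‖x‖ := by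
    rw [lap_congr ((hnhds hx).mono fun y hy => hl1 hy)]
    exact lap_radial hI hpos (hf1.of_le (by norm_num)) hx
  have hl3 {x : EuclideanSpace ℝ (Fin 4)} (hx : ‖x‖ ∈ I) :
      lap (lap (lap (fun y => f ‖y‖))) x = radialLap (radialLap (radialLap f)) ‖x‖ := by
    rw [lap_congr ((hnhds hx).mono fun y hy => hl2 hy)]
    exact lap_radial hI hpos hf2 hx
  have hzero : ∀ r ∈ I, radialLap (radialLap (radialLap f)) r = 0 := fun r hr => by
    have hn : ‖EuclideanSpace.single (0 : Fin 4) r‖ = r := by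
      simp [abs_of_pos (hpos r hr)]
    have hmem : ‖EuclideanSpace.single (0 : Fin 4) r‖ ∈ I := by rwa [hn]
    have h := hl3 hmem
    rw [hu _ hmem.1 hmem.2, hn] at h
    exact h.symm
  obtain ⟨a₂, b₂, h₂⟩ := exists_of_radialLap_eq hI hI' hpos hf2 (a := 0) (b := 0) (c := 0) (d := 0)
    fun r hr => by simp [hzero r hr]
  obtain ⟨a₁, b₁, h₁⟩ := exists_of_radialLap_eq hI hI' hpos (hf1.of_le (by norm_num))
    (a := a₂) (b := b₂) (c := 0) (d := 0) fun r hr => by simp [h₂ r hr]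
  obtain ⟨a₀, b₀, h₀⟩ := exists_of_radialLap_eq hI hI' hpos (hf.of_le (by norm_num))
    (a := a₁) (b := b₁) (c := (1 / 2 : ℝ) • a₂) (d := (1 / 8 : ℝ) • b₂)
    fun r hr => by simp [h₁ r hr]
  exact ⟨![a₀, b₀, (1 / 2 : ℝ) • a₁, (1 / 8 : ℝ) • b₁ - (3 / 32 : ℝ) • (1 / 2 : ℝ) • a₂,
    (1 / 8 : ℝ) • (1 / 2 : ℝ) • a₂, (1 / 24 : ℝ) • (1 / 8 : ℝ) • b₂],
    fun r h1 h2 => h₀ r ⟨h1, h2⟩⟩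
end
end

section
/- Let 0 ≤ τ < σ ≤ ∞ and m ≥ 1, let Y : ℝ⁴ → ℝ be a nonzero harmonic polynomial homogeneous of degree 2, and let f : (τ,σ) → ℝ^m be a six-times continuously differentiable function such that u(x) = f(|x|) Y(x/|x|) satisfies Δ³u = 0 on the open annulus {x ∈ ℝ⁴ : τ < |x| < σ}. Then there exist vectors C₁, …, C₆ ∈ ℝ^m such that f(r) = C₁ r^{-4} + C₂ r^{-2} + C₃ + C₄ r² + C₅ r⁴ + C₆ r⁶ for all r ∈ (τ,σ). -/
noncomputable section

/-- `P : ℝ⁴ → ℝ` is a harmonic polynomial homogeneous of degree `h`. -/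
def IsHarmonicHomog (h : ℕ) (P : EuclideanSpace ℝ (Fin 4) → ℝ) : Prop :=
  (∃ p : MvPolynomial (Fin 4) ℝ, p.IsHomogeneous h ∧
    ∀ x : EuclideanSpace ℝ (Fin 4), P x = MvPolynomial.eval (fun i => x i) p) ∧
  ∀ x, lap P x = 0

/-- The operator `G ↦ 4 s G'' + 16 G'`, which is `Δ` on functions `Y(x) G(|x|²)` for `Y` a harmonic
polynomial on `ℝ⁴` homogeneous of degree two. -/
def radialOp {V : Type*} [NormedAddCommGroup V] [NormedSpace ℝ V] (G : ℝ → V) (s : ℝ) : V :=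
  (4 * s) • deriv (deriv G) s + (16 : ℝ) • deriv G s

section

variable {V : Type*} [NormedAddCommGroup V] [NormedSpace ℝ V]

lemma lap_eqOn {u v : EuclideanSpace ℝ (Fin 4) → V} {A : Set (EuclideanSpace ℝ (Fin 4))}
    (hA : IsOpen A) (h : Set.EqOn u v A) : Set.EqOn (lap u) (lap v) A := by
  intro x hx
  unfold lap
  refine Finset.sum_congr rfl fun i _ => ?_
  congr 1
  refine Filter.EventuallyEq.fderiv_eq ?_
  filter_upwards [hA.mem_nhds hx] with y hy
  rw [Filter.EventuallyEq.fderiv_eq (h.eventuallyEq_of_mem (hA.mem_nhds hy))]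

lemma hasFDerivAt_smul_comp_norm_sq {a : EuclideanSpace ℝ (Fin 4) → ℝ} {g : ℝ → V}
    {x : EuclideanSpace ℝ (Fin 4)} (ha : DifferentiableAt ℝ a x)
    (hg : DifferentiableAt ℝ g (‖x‖ ^ 2)) :
    HasFDerivAt (fun y => a y • g (‖y‖ ^ 2))
      (a x • (ContinuousLinearMap.toSpanSingleton ℝ (deriv g (‖x‖ ^ 2))).comp
        (2 • innerSL ℝ x) + (fderiv ℝ a x).smulRight (g (‖x‖ ^ 2))) x := by
  have h1 : HasFDerivAt (fun y : EuclideanSpace ℝ (Fin 4) => ‖y‖ ^ 2) (2 • innerSL ℝ x) x :=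
    (hasStrictFDerivAt_norm_sq x).hasFDerivAt
  exact ha.hasFDerivAt.smul
    ((hg.hasDerivAt.hasFDerivAt).comp x h1)

lemma fderiv_smul_comp_norm_sq {a : EuclideanSpace ℝ (Fin 4) → ℝ} {g : ℝ → V}
    {x : EuclideanSpace ℝ (Fin 4)} (ha : DifferentiableAt ℝ a x)
    (hg : DifferentiableAt ℝ g (‖x‖ ^ 2)) (i : Fin 4) :
    fderiv ℝ (fun y => a y • g (‖y‖ ^ 2)) x (EuclideanSpace.single i 1) =
      (a x * (2 * x i)) • deriv g (‖x‖ ^ 2) +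
        fderiv ℝ a x (EuclideanSpace.single i 1) • g (‖x‖ ^ 2) := by
  rw [(hasFDerivAt_smul_comp_norm_sq ha hg).fderiv]
  simp [EuclideanSpace.inner_single_right]
  module

lemma lap_smul_comp_norm_sq {Y : EuclideanSpace ℝ (Fin 4) → ℝ} (hYs : ContDiff ℝ 2 Y)
    (hlap : ∀ x, lap Y x = 0) (heuler : ∀ x, fderiv ℝ Y x x = 2 * Y x)
    {J : Set ℝ} (hJ : IsOpen J) {G : ℝ → V} (hG : ContDiffOn ℝ 2 G J)
    {x : EuclideanSpace ℝ (Fin 4)} (hx : ‖x‖ ^ 2 ∈ J) :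
    lap (fun y => Y y • G (‖y‖ ^ 2)) x = Y x • radialOp G (‖x‖ ^ 2) := by
  have hG' : ContDiffOn ℝ 1 (deriv G) J := hG.deriv_of_isOpen hJ (by norm_num)
  have hGd : ∀ s ∈ J, DifferentiableAt ℝ G s := fun s hs =>
    (hG.differentiableOn (by norm_num)).differentiableAt (hJ.mem_nhds hs)
  have hGd' : ∀ s ∈ J, DifferentiableAt ℝ (deriv G) s := fun s hs =>
    (hG'.differentiableOn (by norm_num)).differentiableAt (hJ.mem_nhds hs)
  have hYd : Differentiable ℝ Y := hYs.differentiable (by norm_num)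
  have hA : IsOpen {y : EuclideanSpace ℝ (Fin 4) | ‖y‖ ^ 2 ∈ J} :=
    hJ.preimage (by fun_prop)
  have hYe : ∀ i : Fin 4, Differentiable ℝ
      (fun y => fderiv ℝ Y y (EuclideanSpace.single i 1)) := fun i =>
    ((hYs.fderiv_right (m := 1) (by norm_num)).clm_apply contDiff_const).differentiable
      (by norm_num)
  have hcoord : ∀ i : Fin 4, Differentiable ℝ (fun y : EuclideanSpace ℝ (Fin 4) => y i) :=
    fun i => (EuclideanSpace.proj (𝕜 := ℝ) i).differentiable
  have hfc : ∀ i : Fin 4, fderiv ℝ (fun y : EuclideanSpace ℝ (Fin 4) => y i) x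
      (EuclideanSpace.single i 1) = 1 := fun i => by
    have := (EuclideanSpace.proj (𝕜 := ℝ) i).hasFDerivAt (x := x)
    have h2 : fderiv ℝ (fun y : EuclideanSpace ℝ (Fin 4) => y i) x = EuclideanSpace.proj i :=
      this.fderiv
    rw [h2]; simp
  have key : ∀ i : Fin 4,
      fderiv ℝ (fun y => fderiv ℝ (fun y => Y y • G (‖y‖ ^ 2)) y (EuclideanSpace.single i 1)) x
        (EuclideanSpace.single i 1) =
      (4 * Y x * x i ^ 2) • deriv (deriv G) (‖x‖ ^ 2) +
        (2 * Y x + 4 * (x i * fderiv ℝ Y x (EuclideanSpace.single i 1))) •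
          deriv G (‖x‖ ^ 2) +
        fderiv ℝ (fun y => fderiv ℝ Y y (EuclideanSpace.single i 1)) x
          (EuclideanSpace.single i 1) • G (‖x‖ ^ 2) := by
    intro i
    have e : (fun y => fderiv ℝ (fun y => Y y • G (‖y‖ ^ 2)) y (EuclideanSpace.single i 1))
        =ᶠ[nhds x] fun y => (Y y * (2 * y i)) • deriv G (‖y‖ ^ 2) +
          fderiv ℝ Y y (EuclideanSpace.single i 1) • G (‖y‖ ^ 2) := by
      filter_upwards [hA.mem_nhds hx] with y hy
      exact fderiv_smul_comp_norm_sq hYd.differentiableAt (hGd _ hy) i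
    have d1 : Differentiable ℝ fun y : EuclideanSpace ℝ (Fin 4) => Y y * (2 * y i) :=
      hYd.mul ((hcoord i).const_mul 2)
    rw [e.fderiv_eq, fderiv_fun_add
      (hasFDerivAt_smul_comp_norm_sq d1.differentiableAt (hGd' _ hx)).differentiableAt
      (hasFDerivAt_smul_comp_norm_sq (hYe i).differentiableAt (hGd _ hx)).differentiableAt,
      add_apply,
      fderiv_smul_comp_norm_sq d1.differentiableAt (hGd' _ hx),
      fderiv_smul_comp_norm_sq (hYe i).differentiableAt (hGd _ hx),
      fderiv_fun_mul hYd.differentiableAt ((hcoord i).const_mul 2).differentiableAt,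
      fderiv_const_mul (hcoord i).differentiableAt]
    simp only [add_apply, smul_apply, hfc, smul_eq_mul]
    module
  have hsum : ∑ i : Fin 4, x i * fderiv ℝ Y x (EuclideanSpace.single i 1) = 2 * Y x := by
    rw [← heuler x]
    have := congrArg (fderiv ℝ Y x) ((EuclideanSpace.basisFun (Fin 4) ℝ).sum_repr x)
    simpa [map_sum] using this
  have hl := hlap x
  unfold lap at hl ⊢
  rw [Finset.sum_congr rfl fun i _ => key i, Finset.sum_add_distrib, Finset.sum_add_distrib,
    ← Finset.sum_smul, ← Finset.sum_smul, ← Finset.sum_smul, hl, Finset.sum_add_distrib,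
    ← Finset.mul_sum, ← Finset.mul_sum, ← Finset.mul_sum, hsum, ← EuclideanSpace.real_norm_sq_eq]
  simp only [radialOp, Finset.sum_const, Finset.card_univ, Fintype.card_fin]
  module

lemma ContDiffOn.radialOp {n : ℕ} {J : Set ℝ} (hJ : IsOpen J) {G : ℝ → V}
    (hG : ContDiffOn ℝ (n + 2) G J) : ContDiffOn ℝ n (radialOp G) J := by
  have h1 : ContDiffOn ℝ (n + 1) (deriv G) J :=
    hG.deriv_of_isOpen hJ (by rw [add_assoc, one_add_one_eq_two])
  have h2 : ContDiffOn ℝ n (deriv (deriv G)) J := h1.deriv_of_isOpen hJ le_rfl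
  have h3 : ContDiffOn ℝ n (deriv G) J := h1.of_le le_self_add
  exact ((contDiff_const.mul contDiff_id).contDiffOn.smul h2).add (contDiffOn_const.smul h3)

lemma hasDerivAt_inv_pow (n : ℕ) {s : ℝ} (hs : s ≠ 0) :
    HasDerivAt (fun t : ℝ => (t ^ n)⁻¹) (-n * (s ^ (n + 1))⁻¹) s := by
  refine ((hasDerivAt_pow n s).fun_inv (pow_ne_zero n hs)).congr_deriv ?_
  rcases n with _ | n
  · simp
  · simp only [Nat.add_sub_cancel]
    field_simp
    ring

/-- Solutions of `4 s G'' + 16 G' = 4 s P'' + 16 P'` are `P + a + s⁻³ b`. -/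
lemma exists_eq_of_radialOp_eq {J : Set ℝ} (hJ : IsOpen J) (hJc : IsPreconnected J)
    (hJ0 : ∀ s ∈ J, 0 < s) {G P P' P'' : ℝ → V} (hG : ContDiffOn ℝ 2 G J)
    (hP : ∀ s ∈ J, HasDerivAt P (P' s) s) (hP' : ∀ s ∈ J, HasDerivAt P' (P'' s) s)
    (h : ∀ s ∈ J, radialOp G s = (4 * s) • P'' s + (16 : ℝ) • P' s) :
    ∃ a b : V, ∀ s ∈ J, G s = P s + a + (s ^ 3)⁻¹ • b := by
  have hG' : ContDiffOn ℝ 1 (deriv G) J := hG.deriv_of_isOpen hJ (by norm_num)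
  have hGd : ∀ s ∈ J, HasDerivAt G (deriv G s) s := fun s hs =>
    ((hG.differentiableOn (by norm_num)).differentiableAt (hJ.mem_nhds hs)).hasDerivAt
  have hGd' : ∀ s ∈ J, HasDerivAt (deriv G) (deriv (deriv G) s) s := fun s hs =>
    ((hG'.differentiableOn (by norm_num)).differentiableAt (hJ.mem_nhds hs)).hasDerivAt
  have hF : ∀ s ∈ J, HasDerivAt (fun s => s ^ 4 • (deriv G s - P' s)) 0 s := by
    intro s hs
    refine ((hasDerivAt_pow 4 s).smul ((hGd' s hs).sub (hP' s hs))).congr_deriv ?_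
    have e : s ^ 4 • (deriv (deriv G) s - P'' s) + ((4 : ℕ) * s ^ (4 - 1)) • (deriv G s - P' s) =
        (s ^ 3 / 4) • (radialOp G s - ((4 * s) • P'' s + (16 : ℝ) • P' s)) := by
      unfold radialOp
      push_cast
      module
    simpa [h s hs] using e
  obtain ⟨c, hc⟩ := hJ.exists_is_const_of_deriv_eq_zero hJc
    (fun s hs => (hF s hs).differentiableAt.differentiableWithinAt) (fun s hs => (hF s hs).deriv)
  have hK : ∀ s ∈ J, HasDerivAt (fun s => G s - P s + (s ^ 3)⁻¹ • ((1 / 3 : ℝ) • c)) 0 s := by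
    intro s hs
    have hs0 := (hJ0 s hs).ne'
    refine (((hGd s hs).sub (hP s hs)).add
      ((hasDerivAt_inv_pow 3 hs0).smul_const ((1 / 3 : ℝ) • c))).congr_deriv ?_
    have e : deriv G s - P' s = (s ^ 4)⁻¹ • c := by
      rw [← hc s hs, smul_smul, inv_mul_cancel₀ (pow_ne_zero 4 hs0), one_smul]
    rw [e]
    push_cast
    module
  obtain ⟨a, ha⟩ := hJ.exists_is_const_of_deriv_eq_zero hJc
    (fun s hs => (hK s hs).differentiableAt.differentiableWithinAt) (fun s hs => (hK s hs).deriv)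
  refine ⟨a, -((1 / 3 : ℝ) • c), fun s hs => ?_⟩
  rw [← ha s hs]
  module

lemma exists_eq_of_radialOp_iterate_three_eq_zero {J : Set ℝ} (hJ : IsOpen J)
    (hJc : IsPreconnected J) (hJ0 : ∀ s ∈ J, 0 < s) {G : ℝ → V} (hG : ContDiffOn ℝ 6 G J)
    (h : ∀ s ∈ J, radialOp (radialOp (radialOp G)) s = 0) :
    ∃ C : Fin 6 → V, ∀ s ∈ J, G s = (s ^ 3)⁻¹ • C 0 + (s ^ 2)⁻¹ • C 1 + (s ^ 1)⁻¹ • C 2 + C 3 +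
      s • C 4 + s ^ 2 • C 5 := by
  have hG1 : ContDiffOn ℝ 4 (radialOp G) J :=
    ContDiffOn.radialOp (n := 4) hJ (hG.of_le (by norm_num))
  have hG2 : ContDiffOn ℝ 2 (radialOp (radialOp G)) J :=
    ContDiffOn.radialOp (n := 2) hJ (hG1.of_le (by norm_num))
  obtain ⟨a₀, b₀, h₀⟩ := exists_eq_of_radialOp_eq hJ hJc hJ0 hG2 (P := fun _ => 0)
    (P' := fun _ => 0) (P'' := fun _ => 0) (fun s _ => hasDerivAt_const s 0)
    (fun s _ => hasDerivAt_const s 0) (by simpa using h)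
  obtain ⟨a₁, b₁, h₁⟩ := exists_eq_of_radialOp_eq hJ hJc hJ0 (hG1.of_le (by norm_num))
    (P := fun s => s • (1 / 16 : ℝ) • a₀ + (s ^ 2)⁻¹ • (-1 / 8 : ℝ) • b₀)
    (P' := fun s => (1 / 16 : ℝ) • a₀ + (s ^ 3)⁻¹ • (1 / 4 : ℝ) • b₀)
    (P'' := fun s => (s ^ 4)⁻¹ • (-3 / 4 : ℝ) • b₀)
    (fun s hs => (((hasDerivAt_id s).smul_const _).add
      ((hasDerivAt_inv_pow 2 (hJ0 s hs).ne').smul_const _)).congr_deriv (by push_cast; module))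
    (fun s hs => (((hasDerivAt_const s _)).add
      ((hasDerivAt_inv_pow 3 (hJ0 s hs).ne').smul_const _)).congr_deriv (by push_cast; module))
    (fun s hs => by
      have hs0 := (hJ0 s hs).ne'
      have e : (s ^ 3)⁻¹ = s * (s ^ 4)⁻¹ := by field_simp
      rw [h₀ s hs, e]
      module)
  obtain ⟨a₂, b₂, h₂⟩ := exists_eq_of_radialOp_eq hJ hJc hJ0 (hG.of_le (by norm_num))
    (P := fun s => s ^ 2 • (1 / 640 : ℝ) • a₀ + (s ^ 1)⁻¹ • (1 / 64 : ℝ) • b₀ +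
      (s • (1 / 16 : ℝ) • a₁ + (s ^ 2)⁻¹ • (-1 / 8 : ℝ) • b₁))
    (P' := fun s => s • (1 / 320 : ℝ) • a₀ + (s ^ 2)⁻¹ • (-1 / 64 : ℝ) • b₀ +
      ((1 / 16 : ℝ) • a₁ + (s ^ 3)⁻¹ • (1 / 4 : ℝ) • b₁))
    (P'' := fun s => (1 / 320 : ℝ) • a₀ + (s ^ 3)⁻¹ • (1 / 32 : ℝ) • b₀ +
      (s ^ 4)⁻¹ • (-3 / 4 : ℝ) • b₁)
    (fun s hs => ((((hasDerivAt_pow 2 s).smul_const _).add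
        ((hasDerivAt_inv_pow 1 (hJ0 s hs).ne').smul_const _)).add
      (((hasDerivAt_id s).smul_const _).add
      ((hasDerivAt_inv_pow 2 (hJ0 s hs).ne').smul_const _))).congr_deriv
        (by push_cast; module))
    (fun s hs => ((((hasDerivAt_id s).smul_const _).add
        ((hasDerivAt_inv_pow 2 (hJ0 s hs).ne').smul_const _)).add
      (((hasDerivAt_const s _)).add
      ((hasDerivAt_inv_pow 3 (hJ0 s hs).ne').smul_const _))).congr_deriv
        (by push_cast; module))
    (fun s hs => by
      have hs0 := (hJ0 s hs).ne'
      have e : (s ^ 3)⁻¹ = s * (s ^ 4)⁻¹ := by field_simp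
      have e' : (s ^ 2)⁻¹ = s ^ 2 * (s ^ 4)⁻¹ := by field_simp
      rw [h₁ s hs, e, e']
      module)
  refine ⟨![b₂, (-1 / 8 : ℝ) • b₁, (1 / 64 : ℝ) • b₀, a₂, (1 / 16 : ℝ) • a₁,
    (1 / 640 : ℝ) • a₀], fun s hs => ?_⟩
  rw [h₂ s hs]
  simp only [Matrix.cons_val]
  module

end

lemma IsHarmonicHomog.smul {h : ℕ} {Y : EuclideanSpace ℝ (Fin 4) → ℝ} (hY : IsHarmonicHomog h Y)
    (t : ℝ) (x : EuclideanSpace ℝ (Fin 4)) : Y (t • x) = t ^ h * Y x := by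
  obtain ⟨⟨p, hp, hpY⟩, -⟩ := hY
  rw [hpY, hpY, MvPolynomial.eval_eq, MvPolynomial.eval_eq, Finset.mul_sum]
  refine Finset.sum_congr rfl fun d hd => ?_
  rw [hp.degree_eq_sum_deg_support hd, ← Finset.prod_pow_eq_pow_sum]
  simp only [PiLp.smul_apply, smul_eq_mul, mul_pow, Finset.prod_mul_distrib]
  ring

lemma IsHarmonicHomog.contDiff {h : ℕ} {Y : EuclideanSpace ℝ (Fin 4) → ℝ}
    (hY : IsHarmonicHomog h Y) : ContDiff ℝ 2 Y := by
  obtain ⟨⟨p, -, hpY⟩, -⟩ := hY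
  rw [funext hpY]
  simp only [MvPolynomial.eval_eq]
  fun_prop

lemma IsHarmonicHomog.fderiv_self {h : ℕ} {Y : EuclideanSpace ℝ (Fin 4) → ℝ}
    (hY : IsHarmonicHomog h Y) (x : EuclideanSpace ℝ (Fin 4)) :
    fderiv ℝ Y x x = h * Y x := by
  have h1 : HasDerivAt (fun t : ℝ => Y (t • x)) (fderiv ℝ Y x x) 1 := by
    have hd : HasFDerivAt Y (fderiv ℝ Y x) ((1 : ℝ) • x) := by
      rw [one_smul]
      exact (hY.contDiff.differentiable (by norm_num) x).hasFDerivAt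
    exact (hd.comp_hasDerivAt (1 : ℝ) ((hasDerivAt_id (1 : ℝ)).smul_const x)).congr_deriv
      (by rw [one_smul])
  have h2 : HasDerivAt (fun t : ℝ => Y (t • x)) (h * Y x) 1 := by
    simp only [hY.smul]
    simpa using (hasDerivAt_pow h (1 : ℝ)).mul_const (Y x)
  exact h1.unique h2

/-- a triharmonic function of the form `f(|x|) X(x/|x|)`, with `X` a nonzero
degree-two spherical harmonic, on an annulus in `ℝ⁴` (possibly with outer radius `∞`), has
radial profile `C₁ r⁻⁴ + C₂ r⁻² + C₃ + C₄ r² + C₅ r⁴ + C₆ r⁶`. -/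
theorem stmt2 (m : ℕ) (hm : 1 ≤ m) (τ : ℝ) (σ : EReal) (hτ : 0 ≤ τ) (hτσ : (τ : EReal) < σ)
    (Y : EuclideanSpace ℝ (Fin 4) → ℝ) (hY : IsHarmonicHomog 2 Y) (hY0 : Y ≠ 0)
    (f : ℝ → EuclideanSpace ℝ (Fin m))
    (hf : ContDiffOn ℝ 6 f {r : ℝ | τ < r ∧ (r : EReal) < σ})
    (hu : ∀ x : EuclideanSpace ℝ (Fin 4), τ < ‖x‖ → (‖x‖ : EReal) < σ →
      lap (lap (lap (fun y => Y (‖y‖⁻¹ • y) • f ‖y‖))) x = 0) :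
    ∃ C : Fin 6 → EuclideanSpace ℝ (Fin m), ∀ r : ℝ, τ < r → (r : EReal) < σ →
      f r = (r ^ 4)⁻¹ • C 0 + (r ^ 2)⁻¹ • C 1 + C 2 + r ^ 2 • C 3 +
        r ^ 4 • C 4 + r ^ 6 • C 5 := by
  set J : Set ℝ := {s | 0 < s ∧ τ < √s ∧ (√s : EReal) < σ} with hJdef
  have hJ : IsOpen J := by
    refine (isOpen_lt continuous_const continuous_id).inter
      ((isOpen_lt continuous_const Real.continuous_sqrt).inter
      (isOpen_lt (continuous_coe_real_ereal.comp Real.continuous_sqrt) continuous_const))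
  have hJ0 : ∀ s ∈ J, 0 < s := fun s hs => hs.1
  have hJc : IsPreconnected J := by
    refine Set.OrdConnected.isPreconnected ⟨fun a ha b hb s hs => ⟨ha.1.trans_le hs.1,
      ha.2.1.trans_le (Real.sqrt_le_sqrt hs.1), lt_of_le_of_lt ?_ hb.2.2⟩⟩
    exact_mod_cast Real.sqrt_le_sqrt hs.2
  have hmemJ : ∀ r : ℝ, τ < r → (r : EReal) < σ → r ^ 2 ∈ J := fun r h1 h2 => by
    have hr : 0 < r := hτ.trans_lt h1
    refine ⟨by positivity, ?_, ?_⟩ <;> rwa [Real.sqrt_sq hr.le]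
  set G : ℝ → EuclideanSpace ℝ (Fin m) := fun s => s⁻¹ • f √s with hGdef
  have hG : ContDiffOn ℝ 6 G J := by
    refine (contDiffOn_id.inv fun s hs => (hJ0 s hs).ne').smul
      (hf.comp (fun s hs => (Real.contDiffAt_sqrt (hJ0 s hs).ne').contDiffWithinAt)
        fun s hs => hs.2)
  have hG1 : ContDiffOn ℝ 4 (radialOp G) J :=
    ContDiffOn.radialOp (n := 4) hJ (hG.of_le (by norm_num))
  have hG2 : ContDiffOn ℝ 2 (radialOp (radialOp G)) J :=
    ContDiffOn.radialOp (n := 2) hJ (hG1.of_le (by norm_num))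
  set A : Set (EuclideanSpace ℝ (Fin 4)) := {x | ‖x‖ ^ 2 ∈ J} with hAdef
  have hA : IsOpen A := hJ.preimage (by fun_prop)
  have step : ∀ H : ℝ → EuclideanSpace ℝ (Fin m), ContDiffOn ℝ 2 H J →
      Set.EqOn (lap fun y => Y y • H (‖y‖ ^ 2)) (fun y => Y y • radialOp H (‖y‖ ^ 2)) A :=
    fun H hH x hx => lap_smul_comp_norm_sq hY.contDiff hY.2
      (fun x => by simpa using hY.fderiv_self x) hJ hH hx
  have e0 : Set.EqOn (fun y => Y (‖y‖⁻¹ • y) • f ‖y‖) (fun y => Y y • G (‖y‖ ^ 2)) A := by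
    intro y _
    simp only [hGdef, hY.smul, Real.sqrt_sq (norm_nonneg y), smul_smul, inv_pow]
    rw [mul_comm]
  have e1 := (lap_eqOn hA e0).trans (step G (hG.of_le (by norm_num)))
  have e2 := (lap_eqOn hA e1).trans (step _ (hG1.of_le (by norm_num)))
  have e3 := (lap_eqOn hA e2).trans (step _ hG2)
  obtain ⟨x₀, hx₀⟩ : ∃ x, Y x ≠ 0 := Function.ne_iff.1 hY0
  have hx₀' : x₀ ≠ 0 := by
    rintro rfl
    exact hx₀ (by simpa using hY.smul 0 0)
  have hn : 0 < ‖x₀‖ := norm_pos_iff.2 hx₀'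
  have hzero : ∀ s ∈ J, radialOp (radialOp (radialOp G)) s = 0 := by
    intro s hs
    have ht : 0 < √s / ‖x₀‖ := div_pos (Real.sqrt_pos.2 hs.1) hn
    have hnx : ‖(√s / ‖x₀‖) • x₀‖ = √s := by
      rw [norm_smul, Real.norm_of_nonneg ht.le, div_mul_cancel₀ _ hn.ne']
    have hnx2 : ‖(√s / ‖x₀‖) • x₀‖ ^ 2 = s := by rw [hnx, Real.sq_sqrt hs.1.le]
    have hxA : (√s / ‖x₀‖) • x₀ ∈ A := by rw [hAdef, Set.mem_ofPred_eq, hnx2]; exact hs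
    have h3 := e3 hxA
    rw [hu _ (by rw [hnx]; exact hs.2.1) (by rw [hnx]; exact hs.2.2)] at h3
    simp only [hnx2, hY.smul] at h3
    exact (smul_eq_zero.1 h3.symm).resolve_left (mul_ne_zero (pow_ne_zero 2 ht.ne') hx₀)
  obtain ⟨C, hC⟩ := exists_eq_of_radialOp_iterate_three_eq_zero hJ hJc hJ0 hG hzero
  refine ⟨C, fun r h1 h2 => ?_⟩
  have hr : 0 < r := hτ.trans_lt h1
  have hfr : f r = r ^ 2 • G (r ^ 2) := by
    simp only [hGdef, Real.sqrt_sq hr.le]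
    rw [smul_smul, mul_inv_cancel₀ (by positivity), one_smul]
  rw [hfr, hC _ (hmemJ r h1 h2)]
  simp only [smul_add, smul_smul]
  have q0 : r ^ 2 * ((r ^ 2) ^ 3)⁻¹ = (r ^ 4)⁻¹ := by field_simp
  have q1 : r ^ 2 * ((r ^ 2) ^ 2)⁻¹ = (r ^ 2)⁻¹ := by field_simp
  have q2 : r ^ 2 * ((r ^ 2) ^ 1)⁻¹ = 1 := by field_simp
  rw [q0, q1, q2]
  module
end
end

section
/- Let n ≥ 5, r > 0, and let φ : B_r(0) ⊂ ℝ⁴ → ℝ^{n-4} be of class C⁷ with φ(0) = 0 and Dφ(0) = 0. Let P = D²φ(0) : ℝ⁴ × ℝ⁴ → ℝ^{n-4} and Q = D³φ(0) : ℝ⁴ × ℝ⁴ × ℝ⁴ → ℝ^{n-4} be the second and third derivatives of φ at the origin. Then there exist ρ ∈ (0, r], R > 0, C > 0, an open set Û ⊂ ℝ⁴ containing {ζ ∈ ℝ⁴ : |ζ| > R}, and a three-times continuously differentiable function φ̂ : Û → ℝ^{n-4} such that the image of the punctured graph {(z, φ(z)) : 0 < |z| < ρ} under the inversion I(X) = X/|X|²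 of ℝⁿ \ {0} equals the graph {(ζ, φ̂(ζ)) : ζ ∈ Û}, and φ̂ admits the expansion φ̂(ζ) = (1/2) P(ζ/|ζ|, ζ/|ζ|) + (1/6) Q(ζ/|ζ|, ζ/|ζ|, ζ/|ζ|) |ζ|^{-1} + φ̌(ζ) where the remainder satisfies Σ_{i=0}^{3} |ζ|^{i+2} ‖Dⁱφ̌(ζ)‖ ≤ C for all ζ ∈ Û. -/
noncomputable section

section

open Set Metric Filter Topology

theorem exists_bound_on_segments {E G : Type*} [NormedAddCommGroup E] [NormedSpace ℝ E]
    [ProperSpace E] [NormedAddCommGroup G] {g : E → G} {r : ℝ}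
    (hg : ContinuousOn g (ball 0 r)) {z₀ : E} (hz₀ : z₀ ∈ ball 0 r) :
    ∃ s ∈ 𝓝 z₀, s ⊆ ball 0 r ∧ ∃ M, ∀ z ∈ s, ∀ t ∈ Icc (0 : ℝ) 1,
      t • z ∈ ball (0 : E) r ∧ ‖g (t • z)‖ ≤ M := by
  rw [mem_ball_zero_iff] at hz₀
  obtain ⟨ρ, h1, h2⟩ := exists_between hz₀
  have hsub : closedBall (0 : E) ρ ⊆ ball 0 r := closedBall_subset_ball h2
  obtain ⟨M, hM⟩ := (isCompact_closedBall (0 : E) ρ).exists_bound_of_continuousOn (hg.mono hsub)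
  refine ⟨ball 0 ρ, isOpen_ball.mem_nhds (by simpa using h1), ball_subset_ball h2.le, M, ?_⟩
  intro z hz t ht
  have hmem : t • z ∈ closedBall (0 : E) ρ := by
    rw [mem_closedBall_zero_iff, norm_smul, Real.norm_of_nonneg ht.1]
    rw [mem_ball_zero_iff] at hz
    nlinarith [norm_nonneg z, ht.2]
  exact ⟨hsub hmem, hM _ hmem⟩

theorem continuousOn_smul_comp_smul {E G : Type*} [NormedAddCommGroup E] [NormedSpace ℝ E]
    [NormedAddCommGroup G] [NormedSpace ℝ G] {g : E → G} {r : ℝ} {w : ℝ → ℝ} (hw : Continuous w)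
    (hg : ContinuousOn g (ball 0 r)) {z : E} (hz : z ∈ ball 0 r) :
    ContinuousOn (fun t : ℝ => w t • g (t • z)) (Icc 0 1) := by
  refine hw.continuousOn.smul (hg.comp (by fun_prop) ?_)
  intro t ht
  rw [mem_ball_zero_iff] at hz ⊢
  rw [norm_smul, Real.norm_of_nonneg ht.1]
  nlinarith [norm_nonneg z, ht.2]

theorem continuousOn_integral_smul_comp_smul {E G : Type*} [NormedAddCommGroup E]
    [NormedSpace ℝ E] [ProperSpace E] [NormedAddCommGroup G] [NormedSpace ℝ G] {g : E → G} {r : ℝ}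
    {w : ℝ → ℝ} (hw : Continuous w) (hg : ContinuousOn g (ball 0 r)) :
    ContinuousOn (fun z : E => ∫ t in (0 : ℝ)..1, w t • g (t • z)) (ball 0 r) := by
  intro z₀ hz₀
  obtain ⟨s, hs, hsr, M, hM⟩ := exists_bound_on_segments hg hz₀
  refine ContinuousAt.continuousWithinAt ?_
  have hsub : uIoc (0 : ℝ) 1 ⊆ Icc 0 1 := by
    rw [uIoc_of_le zero_le_one]; exact Ioc_subset_Icc_self
  refine intervalIntegral.continuousAt_of_dominated_interval (bound := fun t => |w t| * M)
    ?_ ?_ ((hw.abs.mul continuous_const).intervalIntegrable _ _) ?_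
  · filter_upwards [hs] with z hz
    exact ((continuousOn_smul_comp_smul hw hg (hsr hz)).mono hsub).aestronglyMeasurable
      measurableSet_uIoc
  · filter_upwards [hs] with z hz
    refine Eventually.of_forall fun t ht => ?_
    rw [norm_smul, Real.norm_eq_abs]
    exact mul_le_mul_of_nonneg_left (hM z hz t (hsub ht)).2 (abs_nonneg _)
  · refine Eventually.of_forall fun t ht => ?_
    have h1 : ContinuousAt g (t • z₀) := hg.continuousAt
      (isOpen_ball.mem_nhds (hM z₀ (mem_of_mem_nhds hs) t (hsub ht)).1)
    exact continuousAt_const.smul (ContinuousAt.comp h1 (by fun_prop))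

theorem hasFDerivAt_integral_smul_comp_smul {E G : Type*} [NormedAddCommGroup E]
    [NormedSpace ℝ E] [ProperSpace E] [NormedAddCommGroup G] [NormedSpace ℝ G] {g : E → G} {r : ℝ}
    {w : ℝ → ℝ} (hw : Continuous w) (hg : ContDiffOn ℝ 1 g (ball 0 r)) {z₀ : E}
    (hz₀ : z₀ ∈ ball 0 r) :
    HasFDerivAt (fun z : E => ∫ t in (0 : ℝ)..1, w t • g (t • z))
      (∫ t in (0 : ℝ)..1, (w t * t) • fderiv ℝ g (t • z₀)) z₀ := by
  have hg' : ContinuousOn (fderiv ℝ g) (ball 0 r) :=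
    hg.continuousOn_fderiv_of_isOpen isOpen_ball le_rfl
  obtain ⟨s, hs, hsr, M, hM⟩ := exists_bound_on_segments hg' hz₀
  have hw' : Continuous fun t => w t * t := by fun_prop
  have hsub : uIoc (0 : ℝ) 1 ⊆ Icc 0 1 := by
    rw [uIoc_of_le zero_le_one]; exact Ioc_subset_Icc_self
  refine intervalIntegral.hasFDerivAt_integral_of_dominated_of_fderiv_le
    (bound := fun t => |w t * t| * M) (F' := fun z t => (w t * t) • fderiv ℝ g (t • z))
    hs ?_ ?_ ?_ ?_ ((hw'.abs.mul continuous_const).intervalIntegrable _ _) ?_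
  · filter_upwards [hs] with z hz
    exact ((continuousOn_smul_comp_smul hw hg.continuousOn (hsr hz)).mono hsub).aestronglyMeasurable
      measurableSet_uIoc
  · refine ContinuousOn.intervalIntegrable ?_
    rw [uIcc_of_le zero_le_one]
    exact continuousOn_smul_comp_smul hw hg.continuousOn hz₀
  · exact ((continuousOn_smul_comp_smul hw' hg' hz₀).mono hsub).aestronglyMeasurable
      measurableSet_uIoc
  · refine Eventually.of_forall fun t ht z hz => ?_
    rw [norm_smul, Real.norm_eq_abs]
    exact mul_le_mul_of_nonneg_left (hM z hz t (hsub ht)).2 (abs_nonneg _)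
  · refine Eventually.of_forall fun t ht z hz => ?_
    have h1 : HasFDerivAt g (fderiv ℝ g (t • z)) (t • z) :=
      ((hg.contDiffAt (isOpen_ball.mem_nhds (hM z hz t (hsub ht)).1)).differentiableAt
        one_ne_zero).hasFDerivAt
    have h2 : HasFDerivAt (fun z : E => t • z) (t • ContinuousLinearMap.id ℝ E) z :=
      (hasFDerivAt_id z).const_smul t
    exact ((h1.comp z h2).const_smul (w t)).congr_fderiv (by ext v; simp [mul_smul])

/-- Integrating a `C^k` function along segments from the origin gives a `C^k` function. -/
theorem contDiffOn_integral_smul_comp_smul.{u} {E : Type u} [NormedAddCommGroup E]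
    [NormedSpace ℝ E] [ProperSpace E] {r : ℝ} (k : ℕ) :
    ∀ {G : Type u} [NormedAddCommGroup G] [NormedSpace ℝ G] {g : E → G} {w : ℝ → ℝ},
      Continuous w → ContDiffOn ℝ k g (ball 0 r) →
    ContDiffOn ℝ k (fun z : E => ∫ t in (0 : ℝ)..1, w t • g (t • z)) (ball 0 r) := by
  induction k with
  | zero =>
    intro G _ _ g w hw hg
    simp only [Nat.cast_zero, contDiffOn_zero] at hg ⊢
    exact continuousOn_integral_smul_comp_smul hw hg
  | succ k ih =>
    intro G _ _ g w hw hg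
    have hg1 : ContDiffOn ℝ 1 g (ball 0 r) := hg.of_le (by norm_cast; omega)
    push_cast at hg ⊢
    rw [contDiffOn_succ_iff_fderiv_of_isOpen isOpen_ball] at hg ⊢
    refine ⟨fun z hz => (hasFDerivAt_integral_smul_comp_smul hw hg1 hz).differentiableAt
      |>.differentiableWithinAt, by simp, ?_⟩
    refine (ih (w := fun t => w t * t) (by fun_prop) hg.2.2).congr fun z hz => ?_
    exact (hasFDerivAt_integral_smul_comp_smul hw hg1 hz).fderiv

/-- Taylor's formula of order four at a zero of second order, with a differentiable remainder
coefficient. -/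
theorem exists_taylor_four.{u} {E F : Type u} [NormedAddCommGroup E] [NormedSpace ℝ E]
    [ProperSpace E] [NormedAddCommGroup F] [NormedSpace ℝ F] [CompleteSpace F] {φ : E → F} {r : ℝ}
    (hr : 0 < r) (hφ : ContDiffOn ℝ 7 φ (ball 0 r)) (hφ0 : φ 0 = 0) (hDφ0 : fderiv ℝ φ 0 = 0) :
    ∃ T : E → E [×4]→L[ℝ] F, ContDiffAt ℝ 3 T 0 ∧ ∀ z ∈ ball 0 r,
      φ z = (2 : ℝ)⁻¹ • iteratedFDeriv ℝ 2 φ 0 (fun _ => z) +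
        (6 : ℝ)⁻¹ • iteratedFDeriv ℝ 3 φ 0 (fun _ => z) + T z (fun _ => z) := by
  have hat : ∀ z ∈ ball (0 : E) r, ContDiffAt ℝ 7 φ z := fun z hz =>
    hφ.contDiffAt (isOpen_ball.mem_nhds hz)
  have hD4 : ContDiffOn ℝ (3 : ℕ) (iteratedFDeriv ℝ 4 φ) (ball 0 r) := fun z hz =>
    ((hat z hz).iteratedFDeriv_right (i := 4) (m := 3) (by norm_num)).contDiffWithinAt
  have hc := contDiffOn_integral_smul_comp_smul 3 (w := fun t => (1 - t) ^ 3) (by fun_prop) hD4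
  refine ⟨fun z => (6 : ℝ)⁻¹ • ∫ t in (0 : ℝ)..1, (1 - t) ^ 3 • iteratedFDeriv ℝ 4 φ (t • z),
    (hc.contDiffAt (ball_mem_nhds _ hr)).const_smul _, fun z hz => ?_⟩
  have hseg : ∀ t ∈ Icc (0 : ℝ) 1, t • z ∈ ball (0 : E) r := fun t ht => by
    rw [mem_ball_zero_iff] at hz ⊢
    rw [norm_smul, Real.norm_of_nonneg ht.1]
    nlinarith [norm_nonneg z, ht.2]
  have h := map_add_eq_sum_add_integral_iteratedFDeriv (f := φ) (x := 0) (y := z) (n := 3)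
    fun t ht => by
      rw [zero_add]
      exact (hat _ (hseg t ht)).of_le (by norm_num)
  have hint : (∫ t in (0 : ℝ)..1, (1 - t) ^ 3 • iteratedFDeriv ℝ 4 φ (t • z)) (fun _ => z) =
      ∫ t in (0 : ℝ)..1, (1 - t) ^ 3 • iteratedFDeriv ℝ 4 φ (t • z) (fun _ => z) := by
    have hi : IntervalIntegrable (fun t : ℝ => (1 - t) ^ 3 • iteratedFDeriv ℝ 4 φ (t • z))
        MeasureTheory.volume 0 1 := by
      refine ContinuousOn.intervalIntegrable ?_
      rw [uIcc_of_le zero_le_one]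
      exact continuousOn_smul_comp_smul (w := fun t => (1 - t) ^ 3) (by fun_prop)
        hD4.continuousOn hz
    exact ((ContinuousMultilinearMap.apply ℝ (fun _ : Fin 4 => E) F
      (fun _ => z)).intervalIntegral_comp_comm hi).symm
  simp only [zero_add] at h
  rw [h]
  simp only [Finset.sum_range_succ, Finset.sum_range_zero]
  rw [smul_apply, hint]
  simp [hφ0, iteratedFDeriv_one_apply, hDφ0, Nat.factorial]

theorem norm_iteratedFDeriv_comp_add_clm_le {E F H : Type*} [NormedAddCommGroup E] [NormedSpace ℝ E]
    [NormedAddCommGroup F] [NormedSpace ℝ F] [NormedAddCommGroup H] [NormedSpace ℝ H]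
    {e : H → F} {L : E →L[ℝ] H} {c : H} {x : E} {n i : ℕ}
    (he : ContDiffAt ℝ n e (c + L x)) (hi : i ≤ n) :
    ‖iteratedFDeriv ℝ i (fun y => e (c + L y)) x‖ ≤
      ‖iteratedFDeriv ℝ i e (c + L x)‖ * ‖L‖ ^ i := by
  set e' : H → F := fun y => e (c + y)
  have he' : ContDiffAt ℝ n e' (L x) := he.comp (L x) (by fun_prop)
  have heq : iteratedFDeriv ℝ i e (c + L x) = iteratedFDeriv ℝ i e' (L x) :=
    (iteratedFDeriv_comp_add_left i c (L x)).symm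
  have hev : ∀ᶠ y in 𝓝 (L x), ContDiffAt ℝ n e' y := he'.eventually (by simp)
  obtain ⟨u, hu, huo, hxu⟩ := _root_.eventually_nhds_iff.1 hev
  have h := L.iteratedFDerivWithin_comp_right (f := e') (n := n)
    (fun y hy => (hu y hy).contDiffWithinAt) huo.uniqueDiffOn
    (huo.preimage L.continuous).uniqueDiffOn hxu (i := i) (mod_cast hi)
  rw [iteratedFDerivWithin_of_isOpen i huo hxu,
    iteratedFDerivWithin_of_isOpen i (huo.preimage L.continuous) hxu] at h
  change ‖iteratedFDeriv ℝ i (e' ∘ L) x‖ ≤ _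
  rw [h, heq]
  refine (ContinuousMultilinearMap.norm_compContinuousLinearMap_le _ _).trans_eq ?_
  simp

/-- A function which, in the blown-up coordinates `(s, x) ↦ s⁻¹ • x`, equals `s ^ 2` times a `C^3`
function near `(0, x₀)` has scale-invariant derivative bounds near infinity in direction `x₀`. -/
theorem exists_eventually_norm_iteratedFDeriv_le {E F : Type*} [NormedAddCommGroup E]
    [NormedSpace ℝ E] [NormedAddCommGroup F] [NormedSpace ℝ F] {f : E → F} {x₀ : E}
    {e : ℝ × E → F} (he : ContDiffAt ℝ 3 e (0, x₀))
    (hfe : ∀ᶠ p : ℝ × E in 𝓝 (0, x₀), 0 < p.1 → f (p.1⁻¹ • p.2) = p.1 ^ 2 • e p) :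
    ∃ C : ℝ, ∀ᶠ p : ℝ × E in 𝓝 (0, x₀), 0 < p.1 → ContDiffAt ℝ 3 f (p.1⁻¹ • p.2) ∧
      ∀ i ≤ 3, ‖iteratedFDeriv ℝ i f (p.1⁻¹ • p.2)‖ ≤ p.1 ^ (i + 2) * C := by
  have hbd : ∀ i ≤ 3, ∀ᶠ p : ℝ × E in 𝓝 (0, x₀),
      ‖iteratedFDeriv ℝ i e p‖ ≤ ‖iteratedFDeriv ℝ i e (0, x₀)‖ + 1 := by
    intro i hi
    have hc : ContinuousAt (iteratedFDeriv ℝ i e) (0, x₀) :=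
      (he.iteratedFDeriv_right (i := i) (m := 0)
        (by rw [zero_add]; exact_mod_cast hi)).continuousAt
    exact (hc.norm.eventually (gt_mem_nhds (lt_add_one _))).mono fun p hp => hp.le
  set C := ∑ i ∈ Finset.range 4, (‖iteratedFDeriv ℝ i e (0, x₀)‖ + 1)
  refine ⟨C, ?_⟩
  have hbd' : ∀ᶠ p : ℝ × E in 𝓝 (0, x₀), ∀ i ∈ Finset.range 4, ‖iteratedFDeriv ℝ i e p‖ ≤ C := by
    rw [Filter.eventually_all_finset]
    intro i hi
    refine (hbd i (by simpa [Nat.lt_succ_iff] using hi)).mono fun p hp => hp.trans ?_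
    exact Finset.single_le_sum (f := fun i => ‖iteratedFDeriv ℝ i e (0, x₀)‖ + 1)
      (fun j _ => by positivity) hi
  have hev : ∀ᶠ p : ℝ × E in 𝓝 (0, x₀), ContDiffAt ℝ 3 e p := he.eventually (by simp)
  filter_upwards [hbd', hev, hfe.eventually_nhds] with p hp1 hp2 hp3 hs
  obtain ⟨s, x⟩ := p
  simp only at hs hp1 hp2 hp3 ⊢
  set ζ := s⁻¹ • x
  set L : E →L[ℝ] ℝ × E := s • ContinuousLinearMap.inr ℝ ℝ E
  have hL : ∀ y, ((s, 0) : ℝ × E) + L y = (s, s • y) := fun y => by simp [L]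
  have hLζ : ((s, 0) : ℝ × E) + L ζ = (s, x) := by
    rw [hL]; simp [ζ, smul_smul, hs.ne']
  have hfeq : f =ᶠ[𝓝 ζ] fun y => s ^ 2 • e ((s, 0) + L y) := by
    have ht : Tendsto (fun y => ((s, 0) : ℝ × E) + L y) (𝓝 ζ) (𝓝 (s, x)) := by
      have : ContinuousAt (fun y => ((s, 0) : ℝ × E) + L y) ζ := by fun_prop
      rw [← hLζ]; exact this
    filter_upwards [ht.eventually hp3] with y hy
    rw [hL] at hy ⊢
    have := hy hs
    simpa [smul_smul, hs.ne'] using this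
  have he1 : ContDiffAt ℝ 3 e ((s, 0) + L ζ) := by rwa [hLζ]
  have hcomp : ContDiffAt ℝ 3 (fun y => e ((s, 0) + L y)) ζ :=
    ContDiffAt.comp ζ he1 (by fun_prop)
  refine ⟨(hcomp.const_smul (s ^ 2)).congr_of_eventuallyEq hfeq, fun i hi => ?_⟩
  have hLn : ‖L‖ ≤ s := by
    refine ContinuousLinearMap.opNorm_le_bound _ hs.le fun y => ?_
    simp [L, norm_smul, abs_of_pos hs, mul_nonneg hs.le (norm_nonneg y)]
  rw [(hfeq.iteratedFDeriv ℝ i).eq_of_nhds]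
  rw [iteratedFDeriv_const_smul_apply' (hcomp.of_le (by exact_mod_cast hi)), norm_smul]
  have h1 := norm_iteratedFDeriv_comp_add_clm_le (n := 3) (by exact_mod_cast he1) hi
  have h2 := hp1 i (by simp; omega)
  rw [hLζ] at h1
  have h3 : ‖L‖ ^ i ≤ s ^ i := pow_le_pow_left₀ (norm_nonneg _) hLn i
  calc ‖s ^ 2‖ * ‖iteratedFDeriv ℝ i (fun y => e ((s, 0) + L y)) ζ‖
      ≤ s ^ 2 * (C * s ^ i) := by
        rw [Real.norm_of_nonneg (by positivity)]
        gcongr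
        exact h1.trans (mul_le_mul h2 h3 (by positivity) ((norm_nonneg _).trans h2))
    _ = s ^ (i + 2) * C := by ring

/-- A function which, in the blown-up coordinates `(s, x) ↦ s⁻¹ • x`, equals `s ^ 2` times a `C^3`
function near every unit direction has scale-invariant derivative bounds near infinity. -/
theorem exists_sum_norm_iteratedFDeriv_le {E F : Type*} [NormedAddCommGroup E]
    [NormedSpace ℝ E] [ProperSpace E] [NormedAddCommGroup F] [NormedSpace ℝ F] {f : E → F}
    (hf : ∀ x₀ : E, ‖x₀‖ = 1 → ∃ e : ℝ × E → F, ContDiffAt ℝ 3 e (0, x₀) ∧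
      ∀ᶠ p : ℝ × E in 𝓝 (0, x₀), 0 < p.1 → f (p.1⁻¹ • p.2) = p.1 ^ 2 • e p) :
    ∃ R > (0 : ℝ), ∃ C > (0 : ℝ), ∀ ζ, R < ‖ζ‖ → ContDiffAt ℝ 3 f ζ ∧
      ∑ i ∈ Finset.range 4, ‖ζ‖ ^ (i + 2) * ‖iteratedFDeriv ℝ i f ζ‖ ≤ C := by
  have key : ∃ C : ℝ, ∀ᶠ s : ℝ in 𝓝 0, ∀ x ∈ sphere (0 : E) 1, 0 < s →
      ContDiffAt ℝ 3 f (s⁻¹ • x) ∧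
      ∀ i ≤ 3, ‖iteratedFDeriv ℝ i f (s⁻¹ • x)‖ ≤ s ^ (i + 2) * C := by
    refine (isCompact_sphere (0 : E) 1).induction_on (p := fun S => ∃ C : ℝ, ∀ᶠ s : ℝ in 𝓝 0,
      ∀ x ∈ S, 0 < s → ContDiffAt ℝ 3 f (s⁻¹ • x) ∧
      ∀ i ≤ 3, ‖iteratedFDeriv ℝ i f (s⁻¹ • x)‖ ≤ s ^ (i + 2) * C) ?_ ?_ ?_ ?_
    · simp
    · rintro S T hST ⟨C, hC⟩
      exact ⟨C, hC.mono fun s hs x hx => hs x (hST hx)⟩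
    · rintro S T ⟨C, hC⟩ ⟨D, hD⟩
      refine ⟨max C D, ?_⟩
      filter_upwards [hC, hD] with s h1 h2 x hx hs
      rcases hx with hx | hx
      · exact ⟨(h1 x hx hs).1, fun i hi => ((h1 x hx hs).2 i hi).trans (by gcongr; simp)⟩
      · exact ⟨(h2 x hx hs).1, fun i hi => ((h2 x hx hs).2 i hi).trans (by gcongr; simp)⟩
    · intro x₀ hx₀
      obtain ⟨e, he, hfe⟩ := hf x₀ (by simpa using hx₀)
      obtain ⟨C, hC⟩ := exists_eventually_norm_iteratedFDeriv_le he hfe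
      rw [nhds_prod_eq, eventually_prod_iff] at hC
      obtain ⟨pa, ha, pb, hb, hab⟩ := hC
      exact ⟨{x | pb x}, mem_nhdsWithin_of_mem_nhds hb, C,
        ha.mono fun s hs x hx => hab hs hx⟩
  obtain ⟨C, hC⟩ := key
  obtain ⟨δ, hδ, hball⟩ := Metric.eventually_nhds_iff.1 hC
  refine ⟨δ⁻¹, by positivity, 4 * |C| + 1, by positivity, fun ζ hζ => ?_⟩
  have hζ0 : 0 < ‖ζ‖ := (inv_pos.2 hδ).trans hζ
  have hs : 0 < ‖ζ‖⁻¹ := inv_pos.2 hζ0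
  have hd : dist ‖ζ‖⁻¹ 0 < δ := by
    rw [Real.dist_0_eq_abs, abs_of_pos hs]
    exact inv_lt_of_inv_lt₀ hδ hζ
  have hx : ‖ζ‖⁻¹ • ζ ∈ sphere (0 : E) 1 := by
    simp [norm_smul, hζ0.ne']
  obtain ⟨h1, h2⟩ := hball hd _ hx hs
  rw [inv_inv, smul_smul, mul_inv_cancel₀ hζ0.ne', one_smul] at h1 h2
  refine ⟨h1, ?_⟩
  have h3 : ∀ i ∈ Finset.range 4, ‖ζ‖ ^ (i + 2) * ‖iteratedFDeriv ℝ i f ζ‖ ≤ |C| := by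
    intro i hi
    have := h2 i (by simp at hi; omega)
    calc ‖ζ‖ ^ (i + 2) * ‖iteratedFDeriv ℝ i f ζ‖
        ≤ ‖ζ‖ ^ (i + 2) * (‖ζ‖⁻¹ ^ (i + 2) * C) := by gcongr
      _ = C := by rw [← mul_assoc, ← mul_pow, mul_inv_cancel₀ hζ0.ne', one_pow, one_mul]
      _ ≤ |C| := le_abs_self C
  refine (Finset.sum_le_card_nsmul _ _ _ h3).trans ?_
  simp

/-- Blown up at the origin, the perturbation `y ↦ (1 + s² β(s, y)) • y` of the identity has a
differentiable local inverse. -/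
theorem exists_local_inverse {E : Type*} [NormedAddCommGroup E] [NormedSpace ℝ E] [CompleteSpace E]
    {β : ℝ × E → ℝ} {x₀ : E} (hβ : ContDiffAt ℝ 3 β (0, x₀)) :
    ∃ H : ℝ × E → E, ContDiffAt ℝ 3 H (0, x₀) ∧ H (0, x₀) = x₀ ∧
      ∀ᶠ p : ℝ × E in 𝓝 (0, x₀), (1 + p.1 ^ 2 * β (p.1, H p)) • H p = p.2 := by
  set Φ : ℝ × E → ℝ × E := fun p => (p.1, (1 + p.1 ^ 2 * β p) • p.2)
  have hΦ : ContDiffAt ℝ 3 Φ (0, x₀) := by fun_prop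
  have hΦ0 : Φ (0, x₀) = (0, x₀) := by simp [Φ]
  have hd : HasFDerivAt Φ
      (ContinuousLinearEquiv.refl ℝ (ℝ × E) : (ℝ × E) →L[ℝ] (ℝ × E)) (0, x₀) := by
    have hβd : HasFDerivAt β (fderiv ℝ β (0, x₀)) (0, x₀) :=
      (hβ.differentiableAt (by norm_num)).hasFDerivAt
    have h1 : HasFDerivAt (fun p : ℝ × E => p.1) (ContinuousLinearMap.fst ℝ ℝ E) (0, x₀) :=
      hasFDerivAt_fst
    have h2 : HasFDerivAt (fun p : ℝ × E => p.2) (ContinuousLinearMap.snd ℝ ℝ E) (0, x₀) :=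
      hasFDerivAt_snd
    have h3 := h1.prodMk ((((h1.pow 2).mul hβd).const_add 1).smul h2)
    refine h3.congr_fderiv ?_
    ext <;> simp
  have hne : (3 : WithTop ℕ∞) ≠ 0 := by norm_num
  set J := hΦ.localInverse hd hne
  have hJ0 : J (0, x₀) = (0, x₀) := by
    have := hΦ.localInverse_apply_image hd hne
    rwa [hΦ0] at this
  have hJ : ContDiffAt ℝ 3 J (0, x₀) := by
    have := hΦ.to_localInverse hd hne
    rwa [hΦ0] at this
  have hr : ∀ᶠ p in 𝓝 (0, x₀), Φ (J p) = p := by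
    have := (hΦ.hasStrictFDerivAt' hd hne).eventually_right_inverse
    rwa [hΦ0] at this
  refine ⟨fun p => (J p).2, contDiffAt_snd.comp _ hJ, congrArg Prod.snd hJ0, ?_⟩
  filter_upwards [hr] with p hp
  have hp1 : (J p).1 = p.1 := (congrArg Prod.fst hp : (Φ (J p)).1 = p.1)
  have hp2 : (1 + (J p).1 ^ 2 * β (J p)) • (J p).2 = p.2 :=
    (congrArg Prod.snd hp : (Φ (J p)).2 = p.2)
  have hJp : (p.1, (J p).2) = J p := by rw [← hp1]
  rw [hJp, ← hp1]
  exact hp2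

/-- The base point change induced on `E` by inverting the graph of `φ`: the point of the inverted
graph over `z` lies above the inversion of `graphInv φ z`. -/
def graphInv {E F : Type*} [NormedAddCommGroup E] [NormedSpace ℝ E] [NormedAddCommGroup F]
    (φ : E → F) (z : E) : E :=
  (1 + ‖φ z‖ ^ 2 / ‖z‖ ^ 2) • z

theorem norm_graphInv_sub_le {E F : Type*} [NormedAddCommGroup E] [InnerProductSpace ℝ E]
    [NormedAddCommGroup F] {φ : E → F} {s : Set E} {K : ℝ} (hK : 0 ≤ K) (h0 : (0 : E) ∈ s)
    (hφ0 : φ 0 = 0) (hφ : ∀ a ∈ s, ∀ b ∈ s, ‖φ a - φ b‖ ≤ K * ‖a - b‖) {a b : E} (ha : a ∈ s)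
    (hb : b ∈ s) : ‖graphInv φ a - graphInv φ b - (a - b)‖ ≤ 3 * K ^ 2 * ‖a - b‖ := by
  have hz : ∀ a ∈ s, ‖φ a‖ ≤ K * ‖a‖ := fun a ha => by simpa [hφ0] using hφ a ha 0 h0
  set N : E → E := fun z => (‖φ z‖ ^ 2 / ‖z‖ ^ 2) • z
  have hG : graphInv φ a - graphInv φ b - (a - b) = N a - N b := by
    simp only [graphInv, N, add_smul, one_smul]; abel
  rw [hG]
  have hN : ∀ a ∈ s, ‖N a‖ ≤ K ^ 2 * ‖a‖ := fun a ha => by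
    rcases eq_or_ne a 0 with rfl | h
    · simp [N]
    · have := norm_pos_iff.2 h
      rw [norm_smul, Real.norm_of_nonneg (by positivity)]
      gcongr
      rw [div_le_iff₀ (by positivity), ← mul_pow]
      exact pow_le_pow_left₀ (norm_nonneg _) (hz a ha) 2
  have hK2 : K ^ 2 ≤ 3 * K ^ 2 := by nlinarith [sq_nonneg K]
  rcases eq_or_ne a 0 with rfl | ha0
  · have := hN b hb
    simp only [N, smul_zero, zero_sub, norm_neg] at this ⊢
    exact this.trans (by gcongr)
  rcases eq_or_ne b 0 with rfl | hb0
  · have := hN a ha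
    simp only [N, smul_zero, sub_zero] at this ⊢
    exact this.trans (by gcongr)
  clear hG
  wlog hab : ‖a‖ ≤ ‖b‖ generalizing a b
  · rw [norm_sub_rev, norm_sub_rev a b]
    exact this hb ha hb0 ha0 (le_of_not_ge hab)
  have hap := norm_pos_iff.2 ha0
  have hbp := norm_pos_iff.2 hb0
  have hinv : ‖(‖a‖ ^ 2)⁻¹ • a - (‖b‖ ^ 2)⁻¹ • b‖ = (‖a‖ * ‖b‖)⁻¹ * ‖a - b‖ := by
    simpa [dist_eq_norm] using dist_div_norm_sq_smul ha0 hb0 1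
  have hdec : N a - N b = ‖φ a‖ ^ 2 • ((‖a‖ ^ 2)⁻¹ • a - (‖b‖ ^ 2)⁻¹ • b) +
      (‖φ a‖ ^ 2 - ‖φ b‖ ^ 2) • (‖b‖ ^ 2)⁻¹ • b := by
    simp only [N, div_eq_mul_inv]
    module
  have hsq : |‖φ a‖ ^ 2 - ‖φ b‖ ^ 2| ≤ K * ‖a - b‖ * (2 * K * ‖b‖) := by
    have h1 : |‖φ a‖ - ‖φ b‖| ≤ K * ‖a - b‖ := (abs_norm_sub_norm_le _ _).trans (hφ a ha b hb)
    have h2 : ‖φ a‖ + ‖φ b‖ ≤ 2 * K * ‖b‖ := by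
      nlinarith [hz a ha, hz b hb, mul_le_mul_of_nonneg_left hab hK]
    rw [sq_sub_sq, abs_mul, mul_comm, abs_of_nonneg (by positivity : 0 ≤ ‖φ a‖ + ‖φ b‖)]
    exact mul_le_mul h1 h2 (by positivity) (by positivity)
  have t1 : ‖‖φ a‖ ^ 2 • ((‖a‖ ^ 2)⁻¹ • a - (‖b‖ ^ 2)⁻¹ • b)‖ ≤ K ^ 2 * ‖a - b‖ := by
    rw [norm_smul, hinv, Real.norm_of_nonneg (by positivity)]
    calc ‖φ a‖ ^ 2 * ((‖a‖ * ‖b‖)⁻¹ * ‖a - b‖)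
        ≤ (K * ‖a‖) ^ 2 * ((‖a‖ * ‖a‖)⁻¹ * ‖a - b‖) := by
          gcongr
          exact hz a ha
      _ = K ^ 2 * ‖a - b‖ := by field_simp
  have t2 : ‖(‖φ a‖ ^ 2 - ‖φ b‖ ^ 2) • (‖b‖ ^ 2)⁻¹ • b‖ ≤ 2 * K ^ 2 * ‖a - b‖ := by
    rw [norm_smul, norm_smul, Real.norm_eq_abs, Real.norm_of_nonneg (by positivity)]
    calc |‖φ a‖ ^ 2 - ‖φ b‖ ^ 2| * ((‖b‖ ^ 2)⁻¹ * ‖b‖)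
        ≤ K * ‖a - b‖ * (2 * K * ‖b‖) * ((‖b‖ ^ 2)⁻¹ * ‖b‖) := by gcongr
      _ = 2 * K ^ 2 * ‖a - b‖ := by field_simp
  rw [hdec]
  exact (norm_add_le _ _).trans (by linarith)

/-- Near a critical zero of `φ`, the map `graphInv φ` is injective and open. -/
theorem exists_graphInv_injOn {E F : Type*} [NormedAddCommGroup E] [InnerProductSpace ℝ E]
    [CompleteSpace E] [NormedAddCommGroup F] [NormedSpace ℝ F] {φ : E → F} {r : ℝ} (hr : 0 < r)
    (hφ0 : φ 0 = 0) (hφ : HasStrictFDerivAt φ (0 : E →L[ℝ] F) 0) :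
    ∃ ρ₀ : ℝ, 0 < ρ₀ ∧ ρ₀ ≤ r ∧ InjOn (graphInv φ) (ball 0 ρ₀) ∧
      (∀ z ∈ ball (0 : E) ρ₀, ‖graphInv φ z‖ ≤ 2 * ‖z‖) ∧
      ∀ ρ ≤ ρ₀, IsOpen (graphInv φ '' ball 0 ρ) := by
  obtain ⟨s, hs, hA⟩ := hφ.approximates_deriv_on_nhds (c := 1 / 4) (Or.inr (by norm_num))
  obtain ⟨ε, hε, hεs⟩ := Metric.mem_nhds_iff.1 hs
  have hL : ∀ a ∈ ball (0 : E) ε, ∀ b ∈ ball (0 : E) ε, ‖φ a - φ b‖ ≤ 1 / 4 * ‖a - b‖ :=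
    fun a ha b hb => by simpa using hA a (hεs ha) b (hεs hb)
  have hG : ∀ a ∈ ball (0 : E) ε, ∀ b ∈ ball (0 : E) ε,
      ‖graphInv φ a - graphInv φ b - (a - b)‖ ≤ 1 / 2 * ‖a - b‖ := fun a ha b hb =>
    (norm_graphInv_sub_le (by norm_num) (mem_ball_self hε) hφ0 hL ha hb).trans (by
      gcongr; norm_num)
  have happ : ApproximatesLinearOn (graphInv φ)
      ((ContinuousLinearEquiv.refl ℝ E : E ≃L[ℝ] E) : E →L[ℝ] E) (ball 0 ε) (1 / 2) :=
    fun a ha b hb => by simpa using hG a ha b hb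
  have hc : Subsingleton E ∨
      (1 / 2 : NNReal) < ‖((ContinuousLinearEquiv.refl ℝ E).symm : E →L[ℝ] E)‖₊⁻¹ := by
    rcases subsingleton_or_nontrivial E with h | h
    · exact Or.inl h
    · right
      have : ‖((ContinuousLinearEquiv.refl ℝ E).symm : E →L[ℝ] E)‖₊ = 1 :=
        NNReal.eq (ContinuousLinearMap.norm_id (𝕜 := ℝ) (E := E))
      rw [this]
      exact_mod_cast (by norm_num : (1 / 2 : ℝ) < 1⁻¹)
  refine ⟨min ε r, lt_min hε hr, min_le_right _ _,
    (happ.injOn hc).mono (ball_subset_ball (min_le_left _ _)), fun z hz => ?_, fun ρ hρ => ?_⟩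
  · have h := hG z (ball_subset_ball (min_le_left _ _) hz) 0 (mem_ball_self hε)
    have h' : ‖graphInv φ z - z‖ ≤ 1 / 2 * ‖z‖ := by simpa [graphInv] using h
    have := norm_sub_norm_le (graphInv φ z) z
    linarith [norm_nonneg z]
  · exact ((happ.mono_set (ball_subset_ball (hρ.trans (min_le_left _ _)))).toOpenPartialHomeomorph
      _ _ hc isOpen_ball).open_target

/-- The function whose graph is the inversion of the graph of `φ` over `s`. -/
def invertedGraph {E F : Type*} [NormedAddCommGroup E] [NormedSpace ℝ E] [NormedAddCommGroup F]
    [NormedSpace ℝ F] (φ : E → F) (s : Set E) (ζ : E) : F :=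
  (‖Function.invFunOn (graphInv φ) s ((‖ζ‖ ^ 2)⁻¹ • ζ)‖ ^ 2 +
      ‖φ (Function.invFunOn (graphInv φ) s ((‖ζ‖ ^ 2)⁻¹ • ζ))‖ ^ 2)⁻¹ •
    φ (Function.invFunOn (graphInv φ) s ((‖ζ‖ ^ 2)⁻¹ • ζ))

/-- The part of `invertedGraph φ s` not accounted for by the second and third derivatives of `φ`
at the origin. -/
def invertedGraphRem {E F : Type*} [NormedAddCommGroup E] [NormedSpace ℝ E]
    [NormedAddCommGroup F] [NormedSpace ℝ F] (φ : E → F) (s : Set E) (ζ : E) : F :=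
  invertedGraph φ s ζ - (2 : ℝ)⁻¹ • iteratedFDeriv ℝ 2 φ 0 (fun _ => ‖ζ‖⁻¹ • ζ) -
    ((6 : ℝ)⁻¹ * ‖ζ‖⁻¹) • iteratedFDeriv ℝ 3 φ 0 (fun _ => ‖ζ‖⁻¹ • ζ)

theorem inv_norm_sq_smul_inv_norm_sq_smul {E : Type*} [NormedAddCommGroup E] [NormedSpace ℝ E]
    (x : E) : (‖(‖x‖ ^ 2)⁻¹ • x‖ ^ 2)⁻¹ • (‖x‖ ^ 2)⁻¹ • x = x := by
  rcases eq_or_ne x 0 with rfl | hx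
  · simp
  have := norm_pos_iff.2 hx
  rw [norm_smul, Real.norm_of_nonneg (by positivity), smul_smul]
  convert one_smul ℝ x using 2
  field_simp

theorem inversion_smul_eq_graphInv {E F : Type*} [NormedAddCommGroup E] [NormedSpace ℝ E]
    [NormedAddCommGroup F] (φ : E → F) {z : E} (hz : z ≠ 0) :
    (‖(‖z‖ ^ 2 + ‖φ z‖ ^ 2)⁻¹ • z‖ ^ 2)⁻¹ • (‖z‖ ^ 2 + ‖φ z‖ ^ 2)⁻¹ • z = graphInv φ z := by
  have := norm_pos_iff.2 hz
  rw [norm_smul, Real.norm_of_nonneg (by positivity), smul_smul, graphInv]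
  congr 1
  field_simp

theorem invertedGraph_apply {E F : Type*} [NormedAddCommGroup E] [NormedSpace ℝ E]
    [NormedAddCommGroup F] [NormedSpace ℝ F] {φ : E → F} {s : Set E} (hs : InjOn (graphInv φ) s)
    {z : E} (hz : z ∈ s) (hz0 : z ≠ 0) :
    invertedGraph φ s ((‖z‖ ^ 2 + ‖φ z‖ ^ 2)⁻¹ • z) = (‖z‖ ^ 2 + ‖φ z‖ ^ 2)⁻¹ • φ z := by
  rw [invertedGraph, inversion_smul_eq_graphInv φ hz0, hs.leftInvOn_invFunOn hz]

/-- The remainder of the inverted graph, computed at the point above which the point of the graph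
over `s • h` is mapped, where `φ (s • h) = s ^ 2 • (2⁻¹ • P h + (s / 6) • Q h + s ^ 2 • v)`. -/
theorem invertedGraphRem_apply {E F : Type*} [NormedAddCommGroup E] [NormedSpace ℝ E]
    [NormedAddCommGroup F] [NormedSpace ℝ F] {φ : E → F} {S : Set E} (hS : InjOn (graphInv φ) S)
    {s b : ℝ} {h x : E} {u v : F} (hs : 0 < s) (hh : h ≠ 0) (hsh : s • h ∈ S)
    (hφ : φ (s • h) = s ^ 2 • u)
    (hu : u = (2 : ℝ)⁻¹ • iteratedFDeriv ℝ 2 φ 0 (fun _ => h) +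
      (6⁻¹ * s) • iteratedFDeriv ℝ 3 φ 0 (fun _ => h) + s ^ 2 • v)
    (hb : b = ‖u‖ ^ 2 / ‖h‖ ^ 2) (hx : (1 + s ^ 2 * b) • h = (‖x‖ ^ 2)⁻¹ • x) :
    invertedGraphRem φ S (s⁻¹ • x) = s ^ 2 •
      ((-(2⁻¹ * b / (1 + s ^ 2 * b) / ‖h‖ ^ 2)) • iteratedFDeriv ℝ 2 φ 0 (fun _ => h) +
        (-(6⁻¹ * s * b * (2 + s ^ 2 * b) / (1 + s ^ 2 * b) / ‖h‖ ^ 2)) •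
          iteratedFDeriv ℝ 3 φ 0 (fun _ => h) +
        ((1 + s ^ 2 * b) * ‖h‖ ^ 2)⁻¹ • v) := by
  have hk := norm_pos_iff.2 hh
  have hb0 : 0 ≤ b := by rw [hb]; positivity
  have hl : 0 < 1 + s ^ 2 * b := by positivity
  have hx' : x = ((1 + s ^ 2 * b) * ‖h‖ ^ 2)⁻¹ • h := by
    rw [← inv_norm_sq_smul_inv_norm_sq_smul x, ← hx, norm_smul, Real.norm_of_nonneg hl.le,
      smul_smul]
    congr 1
    field_simp
  have hD : ‖s • h‖ ^ 2 + ‖φ (s • h)‖ ^ 2 = s ^ 2 * ((1 + s ^ 2 * b) * ‖h‖ ^ 2) := by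
    rw [hφ, norm_smul, norm_smul, Real.norm_of_nonneg hs.le, Real.norm_of_nonneg (by positivity),
      hb]
    field_simp
  have hζ : s⁻¹ • x = (‖s • h‖ ^ 2 + ‖φ (s • h)‖ ^ 2)⁻¹ • s • h := by
    rw [hD, hx', smul_smul, smul_smul]
    congr 1
    field_simp
  have hn : ‖s⁻¹ • x‖ = (s * (1 + s ^ 2 * b) * ‖h‖)⁻¹ := by
    rw [hx', smul_smul, norm_smul, Real.norm_of_nonneg (by positivity)]
    field_simp
  have hdir : ‖s⁻¹ • x‖⁻¹ • s⁻¹ • x = ‖h‖⁻¹ • h := by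
    rw [hn, hx', smul_smul, smul_smul]
    congr 1
    field_simp
  have hm : ∀ (k : ℕ) (A : ContinuousMultilinearMap ℝ (fun _ : Fin k => E) F),
      A (fun _ => ‖h‖⁻¹ • h) = (‖h‖⁻¹ ^ k) • A (fun _ => h) := fun k A => by
    simpa using A.map_smul_univ (fun _ => ‖h‖⁻¹) (fun _ => h)
  rw [invertedGraphRem, hdir, hm, hm, hn, hζ,
    invertedGraph_apply hS hsh (smul_ne_zero hs.ne' hh), hD, hφ, hu]
  match_scalars <;> field_simp <;> ring

theorem ContDiffAt.continuousMultilinearMap_apply_diag {X E F : Type*} [NormedAddCommGroup X]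
    [NormedSpace ℝ X] [NormedAddCommGroup E] [NormedSpace ℝ E] [NormedAddCommGroup F]
    [NormedSpace ℝ F] {k : ℕ} {m : WithTop ℕ∞} {A : X → E [×k]→L[ℝ] F} {g : X → E} {x : X}
    (hA : ContDiffAt ℝ m A x) (hg : ContDiffAt ℝ m g x) :
    ContDiffAt ℝ m (fun y => A y (fun _ => g y)) x := by
  induction k with
  | zero =>
    have := (continuousMultilinearCurryFin0 ℝ E F).contDiff.contDiffAt.comp x hA
    refine this.congr_of_eventuallyEq (.of_forall fun y => ?_)
    exact congrArg (A y) (Subsingleton.elim _ _)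
  | succ k ih =>
    have hL : ContDiff ℝ m (ContinuousMultilinearMap.curryLeft :
        (E [×(k + 1)]→L[ℝ] F) → E →L[ℝ] E [×k]→L[ℝ] F) :=
      (IsLinearMap.with_bound ⟨fun _ _ => rfl, fun _ _ => rfl⟩ 1 fun A => by
        rw [one_mul, ContinuousMultilinearMap.curryLeft_norm]).contDiff
    have h1 := hL.contDiffAt.comp x hA
    refine (ih (h1.clm_apply hg)).congr_of_eventuallyEq (.of_forall fun y => ?_)
    refine congrArg (A y) (funext fun i => ?_)
    refine Fin.cases ?_ (fun j => ?_) i <;> simp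

/-- In the coordinates `(s, x)` of the blow-up at infinity, `ζ = s⁻¹ • x`, the remainder of the
inverted graph is `s ^ 2` times a function which is differentiable up to `s = 0`. -/
theorem exists_invertedGraphRem_eq {E F : Type*} [NormedAddCommGroup E] [InnerProductSpace ℝ E]
    [CompleteSpace E] [NormedAddCommGroup F] [InnerProductSpace ℝ F] {φ : E → F} {ρ : ℝ}
    (hρ : 0 < ρ) (hG : InjOn (graphInv φ) (ball 0 ρ)) {T : E → E [×4]→L[ℝ] F}
    (hT : ContDiffAt ℝ 3 T 0)
    (hφT : ∀ z ∈ ball 0 ρ, φ z = (2 : ℝ)⁻¹ • iteratedFDeriv ℝ 2 φ 0 (fun _ => z) +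
      (6 : ℝ)⁻¹ • iteratedFDeriv ℝ 3 φ 0 (fun _ => z) + T z (fun _ => z))
    {x₀ : E} (hx₀ : ‖x₀‖ = 1) :
    ∃ e : ℝ × E → F, ContDiffAt ℝ 3 e (0, x₀) ∧ ∀ᶠ p : ℝ × E in 𝓝 (0, x₀),
      0 < p.1 → invertedGraphRem φ (ball 0 ρ) (p.1⁻¹ • p.2) = p.1 ^ 2 • e p := by
  have hx₀' : x₀ ≠ 0 := by rintro rfl; simp at hx₀
  set P : E → F := fun y => iteratedFDeriv ℝ 2 φ 0 (fun _ => y)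
  set Q : E → F := fun y => iteratedFDeriv ℝ 3 φ 0 (fun _ => y)
  set v : ℝ × E → F := fun p => T (p.1 • p.2) (fun _ => p.2)
  set u : ℝ × E → F := fun p => (2 : ℝ)⁻¹ • P p.2 + (6⁻¹ * p.1) • Q p.2 + p.1 ^ 2 • v p
  set β : ℝ × E → ℝ := fun p => ‖u p‖ ^ 2 / ‖p.2‖ ^ 2
  have hP : ContDiff ℝ 3 P :=
    (iteratedFDeriv ℝ 2 φ 0).contDiff.comp (contDiff_pi.2 fun _ => contDiff_id)
  have hQ : ContDiff ℝ 3 Q :=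
    (iteratedFDeriv ℝ 3 φ 0).contDiff.comp (contDiff_pi.2 fun _ => contDiff_id)
  have hv : ContDiffAt ℝ 3 v (0, x₀) := by
    have h1 : ContDiffAt ℝ 3 (fun p : ℝ × E => T (p.1 • p.2)) (0, x₀) :=
      ContDiffAt.comp (0, x₀) (g := T) (by simpa using hT)
        (contDiffAt_fst.smul contDiffAt_snd)
    exact h1.continuousMultilinearMap_apply_diag contDiffAt_snd
  have hu : ContDiffAt ℝ 3 u (0, x₀) := by fun_prop
  have hβ : ContDiffAt ℝ 3 β (0, x₀) :=
    (hu.norm_sq ℝ).div (contDiffAt_snd.norm_sq ℝ) (by simpa using hx₀')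
  obtain ⟨H, hH, hH0, hHe⟩ := exists_local_inverse hβ
  set ι : ℝ × E → ℝ × E := fun p => (p.1, (‖p.2‖ ^ 2)⁻¹ • p.2)
  have hι : ContDiffAt ℝ 3 ι (0, x₀) :=
    contDiffAt_fst.prodMk (((contDiffAt_snd.norm_sq ℝ).inv (by simpa using hx₀')).smul
      contDiffAt_snd)
  have hι0 : ι (0, x₀) = (0, x₀) := by simp [ι, hx₀]
  set h : ℝ × E → E := fun p => H (ι p)
  have hh : ContDiffAt ℝ 3 h (0, x₀) :=
    ContDiffAt.comp (0, x₀) (g := H) (by rwa [hι0]) hι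
  have hh0 : h (0, x₀) = x₀ := by simp only [h, hι0, hH0]
  have hk : ContDiffAt ℝ 3 (fun p : ℝ × E => (p.1, h p)) (0, x₀) := contDiffAt_fst.prodMk hh
  have hb : ContDiffAt ℝ 3 (fun p : ℝ × E => β (p.1, h p)) (0, x₀) :=
    ContDiffAt.comp (0, x₀) (g := β) (by simpa only [hh0] using hβ) hk
  have hvh : ContDiffAt ℝ 3 (fun p : ℝ × E => v (p.1, h p)) (0, x₀) :=
    ContDiffAt.comp (0, x₀) (g := v) (by simpa only [hh0] using hv) hk
  have hPh : ContDiffAt ℝ 3 (fun p => P (h p)) (0, x₀) := hP.contDiffAt.comp _ hh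
  have hQh : ContDiffAt ℝ 3 (fun p => Q (h p)) (0, x₀) := hQ.contDiffAt.comp _ hh
  have hl : ContDiffAt ℝ 3 (fun p : ℝ × E => 1 + p.1 ^ 2 * β (p.1, h p)) (0, x₀) :=
    contDiffAt_const.add ((contDiffAt_fst.pow 2).mul hb)
  have hn : ContDiffAt ℝ 3 (fun p : ℝ × E => ‖h p‖ ^ 2) (0, x₀) := hh.norm_sq ℝ
  have hn0 : ‖h (0, x₀)‖ ^ 2 ≠ 0 := by simp [hh0, hx₀]
  have hl0 : 1 + ((0, x₀) : ℝ × E).1 ^ 2 * β (((0, x₀) : ℝ × E).1, h (0, x₀)) ≠ 0 := by simp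
  refine ⟨fun p =>
    (-(2⁻¹ * β (p.1, h p) / (1 + p.1 ^ 2 * β (p.1, h p)) / ‖h p‖ ^ 2)) • P (h p) +
      (-(6⁻¹ * p.1 * β (p.1, h p) * (2 + p.1 ^ 2 * β (p.1, h p)) /
        (1 + p.1 ^ 2 * β (p.1, h p)) / ‖h p‖ ^ 2)) • Q (h p) +
      ((1 + p.1 ^ 2 * β (p.1, h p)) * ‖h p‖ ^ 2)⁻¹ • v (p.1, h p), ?_, ?_⟩
  · refine ContDiffAt.add (ContDiffAt.add ?_ ?_) ?_
    · exact ContDiffAt.smul (((contDiffAt_const.mul hb).div hl hl0).div hn hn0).neg hPh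
    · refine ContDiffAt.smul (ContDiffAt.neg (ContDiffAt.div (ContDiffAt.div ?_ hl hl0) hn hn0)) hQh
      exact ((contDiffAt_const.mul contDiffAt_fst).mul hb).mul
        (contDiffAt_const.add ((contDiffAt_fst.pow 2).mul hb))
    · exact ((hl.mul hn).inv (mul_ne_zero hl0 hn0)).smul hvh
  · have e1 : ∀ᶠ p in 𝓝 ((0, x₀) : ℝ × E),
        (1 + p.1 ^ 2 * β (p.1, h p)) • h p = (‖p.2‖ ^ 2)⁻¹ • p.2 := by
      have : Tendsto ι (𝓝 (0, x₀)) (𝓝 (0, x₀)) := by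
        simpa only [hι0] using hι.continuousAt.tendsto
      exact this.eventually hHe
    have e2 : ∀ᶠ p in 𝓝 ((0, x₀) : ℝ × E), h p ≠ 0 :=
      hh.continuousAt.eventually_ne (by rwa [hh0])
    have e3 : ∀ᶠ p in 𝓝 ((0, x₀) : ℝ × E), p.1 • h p ∈ ball (0 : E) ρ := by
      have : ContinuousAt (fun p : ℝ × E => p.1 • h p) (0, x₀) :=
        continuousAt_fst.smul hh.continuousAt
      exact this.eventually_mem (by simpa using ball_mem_nhds (0 : E) hρ)
    filter_upwards [e1, e2, e3] with p h1 h2 h3 hp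
    refine invertedGraphRem_apply hG hp h2 h3 (u := u (p.1, h p)) ?_ rfl rfl h1
    have hm : ∀ (k : ℕ) (A : ContinuousMultilinearMap ℝ (fun _ : Fin k => E) F),
        A (fun _ => p.1 • h p) = (p.1 ^ k) • A (fun _ => h p) := fun k A => by
      simpa using A.map_smul_univ (fun _ => p.1) (fun _ => h p)
    rw [hφT _ h3, hm, hm, hm]
    simp only [u, P, Q, v]
    module

/-- The inversion at the unit sphere maps the graph of `φ` over `ball 0 ρ`, punctured at the origin,
onto the graph of `invertedGraph φ s`. -/
theorem inversion_image_graph {E F : Type*} [NormedAddCommGroup E] [InnerProductSpace ℝ E]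
    [NormedAddCommGroup F] [InnerProductSpace ℝ F] {φ : E → F} {s : Set E}
    (hs : InjOn (graphInv φ) s) {ρ : ℝ} (hρ : ball 0 ρ ⊆ s) :
    (fun X : WithLp 2 (E × F) => (‖X‖ ^ 2)⁻¹ • X) ''
        ((fun z => (WithLp.equiv 2 (E × F)).symm (z, φ z)) '' {z | 0 < ‖z‖ ∧ ‖z‖ < ρ}) =
      (fun ζ => (WithLp.equiv 2 (E × F)).symm (ζ, invertedGraph φ s ζ)) ''
        {ζ | ζ ≠ 0 ∧ (‖ζ‖ ^ 2)⁻¹ • ζ ∈ graphInv φ '' ball 0 ρ} := by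
  have hinv : ∀ z ∈ s, z ≠ 0 →
      (‖(WithLp.equiv 2 (E × F)).symm (z, φ z)‖ ^ 2)⁻¹ • (WithLp.equiv 2 (E × F)).symm (z, φ z) =
        (WithLp.equiv 2 (E × F)).symm ((‖z‖ ^ 2 + ‖φ z‖ ^ 2)⁻¹ • z,
          invertedGraph φ s ((‖z‖ ^ 2 + ‖φ z‖ ^ 2)⁻¹ • z)) := fun z hz hz0 => by
    rw [invertedGraph_apply hs hz hz0, WithLp.prod_norm_sq_eq_of_L2]
    rfl
  rw [image_image]
  apply Subset.antisymm
  · rintro _ ⟨z, ⟨hz0, hz⟩, rfl⟩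
    have hz0' := norm_pos_iff.1 hz0
    have hzb : z ∈ ball 0 ρ := mem_ball_zero_iff.2 hz
    refine ⟨(‖z‖ ^ 2 + ‖φ z‖ ^ 2)⁻¹ • z, ⟨smul_ne_zero (by positivity) hz0', ?_⟩,
      (hinv z (hρ hzb) hz0').symm⟩
    exact inversion_smul_eq_graphInv φ hz0' ▸ mem_image_of_mem _ hzb
  · rintro _ ⟨ζ, ⟨hζ, z, hz, hzζ⟩, rfl⟩
    have hz0 : z ≠ 0 := by
      rintro rfl
      have : ‖ζ‖ ≠ 0 := norm_ne_zero_iff.2 hζ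
      have h0 : (‖ζ‖ ^ 2)⁻¹ • ζ ≠ 0 := smul_ne_zero (by positivity) hζ
      exact h0 (by rw [← hzζ]; simp [graphInv])
    have hζz : (‖z‖ ^ 2 + ‖φ z‖ ^ 2)⁻¹ • z = ζ := by
      rw [← inv_norm_sq_smul_inv_norm_sq_smul ((‖z‖ ^ 2 + ‖φ z‖ ^ 2)⁻¹ • z),
        inversion_smul_eq_graphInv φ hz0, hzζ, inv_norm_sq_smul_inv_norm_sq_smul]
    refine ⟨z, ⟨norm_pos_iff.2 hz0, mem_ball_zero_iff.1 hz⟩, ?_⟩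
    simp only [hinv z (hρ hz) hz0, hζz]

theorem contDiffAt_invertedGraph {E F : Type*} [NormedAddCommGroup E] [InnerProductSpace ℝ E]
    [NormedAddCommGroup F] [NormedSpace ℝ F] {φ : E → F} {s : Set E} {ζ : E} (hζ : ζ ≠ 0)
    {m : WithTop ℕ∞} (h : ContDiffAt ℝ m (invertedGraphRem φ s) ζ) :
    ContDiffAt ℝ m (invertedGraph φ s) ζ := by
  have hn : ContDiffAt ℝ m (fun ζ : E => ‖ζ‖⁻¹) ζ :=
    (contDiffAt_norm ℝ hζ).inv (norm_ne_zero_iff.2 hζ)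
  have hd : ContDiffAt ℝ m (fun ζ : E => ‖ζ‖⁻¹ • ζ) ζ := hn.smul contDiffAt_id
  have hA : ∀ (k : ℕ) (A : E [×k]→L[ℝ] F),
      ContDiffAt ℝ m (fun ζ => A (fun _ => ‖ζ‖⁻¹ • ζ)) ζ := fun k A =>
    A.contDiff.contDiffAt.comp ζ (contDiffAt_pi.2 fun _ => hd)
  refine ((h.add ((contDiffAt_const (c := (6 : ℝ)⁻¹).mul hn).smul
    (hA 3 (iteratedFDeriv ℝ 3 φ 0)))).add
    ((hA 2 (iteratedFDeriv ℝ 2 φ 0)).const_smul (2 : ℝ)⁻¹)).congr_of_eventuallyEq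
      (.of_forall fun ζ => ?_)
  simp only [invertedGraphRem, Pi.smul_apply']
  abel

end


/-- expansion at infinity of the inversion of a graph.  `ℝⁿ` is identified with
the `L²`-product `ℝ⁴ × ℝ^{n-4}`, the inversion is `I(X) = X/|X|²`, and the image of the
punctured graph of `φ` near `0` is a graph at infinity whose graph function expands as
`(1/2)P(ζ/|ζ|,ζ/|ζ|) + (1/6)Q(ζ/|ζ|,ζ/|ζ|,ζ/|ζ|)|ζ|⁻¹ + φ̌(ζ)` with
`Σ_{i=0}^3 |ζ|^{i+2}‖Dⁱφ̌(ζ)‖ ≤ C`. -/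
theorem stmt16 (n : ℕ) (hn : 5 ≤ n) (r : ℝ) (hr : 0 < r)
    (φ : EuclideanSpace ℝ (Fin 4) → EuclideanSpace ℝ (Fin (n - 4)))
    (hφ : ContDiffOn ℝ 7 φ (Metric.ball 0 r))
    (hφ0 : φ 0 = 0) (hDφ0 : fderiv ℝ φ 0 = 0) :
    ∃ ρ : ℝ, 0 < ρ ∧ ρ ≤ r ∧ ∃ R > (0 : ℝ), ∃ C > (0 : ℝ),
      ∃ U : Set (EuclideanSpace ℝ (Fin 4)), IsOpen U ∧ {ζ | R < ‖ζ‖} ⊆ U ∧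
      ∃ φhat : EuclideanSpace ℝ (Fin 4) → EuclideanSpace ℝ (Fin (n - 4)),
        ContDiffOn ℝ 3 φhat U ∧
        ((fun X : WithLp 2 (EuclideanSpace ℝ (Fin 4) × EuclideanSpace ℝ (Fin (n - 4))) =>
            (‖X‖ ^ 2)⁻¹ • X) ''
          ((fun z => (WithLp.equiv 2
              (EuclideanSpace ℝ (Fin 4) × EuclideanSpace ℝ (Fin (n - 4)))).symm (z, φ z)) ''
            {z | 0 < ‖z‖ ∧ ‖z‖ < ρ})
          = (fun ζ => (WithLp.equiv 2
              (EuclideanSpace ℝ (Fin 4) × EuclideanSpace ℝ (Fin (n - 4)))).symm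
              (ζ, φhat ζ)) '' U) ∧
        ∃ φrem : EuclideanSpace ℝ (Fin 4) → EuclideanSpace ℝ (Fin (n - 4)),
          (∀ ζ ∈ U, φhat ζ =
            (2 : ℝ)⁻¹ • (iteratedFDeriv ℝ 2 φ 0 ![‖ζ‖⁻¹ • ζ, ‖ζ‖⁻¹ • ζ]) +
            ((6 : ℝ)⁻¹ * ‖ζ‖⁻¹) •
              (iteratedFDeriv ℝ 3 φ 0 ![‖ζ‖⁻¹ • ζ, ‖ζ‖⁻¹ • ζ, ‖ζ‖⁻¹ • ζ]) +
            φrem ζ) ∧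
          ∀ ζ ∈ U, ∑ i ∈ Finset.range 4, ‖ζ‖ ^ (i + 2) * ‖iteratedFDeriv ℝ i φrem ζ‖ ≤ C := by
  have hs : HasStrictFDerivAt φ
      (0 : EuclideanSpace ℝ (Fin 4) →L[ℝ] EuclideanSpace ℝ (Fin (n - 4))) 0 :=
    hDφ0 ▸ (hφ.contDiffAt (Metric.ball_mem_nhds _ hr)).hasStrictFDerivAt (by norm_num)
  obtain ⟨ρ₀, hρ₀, hρ₀r, hinj, hle, hopen⟩ := exists_graphInv_injOn hr hφ0 hs
  obtain ⟨T, hT, hφT⟩ := exists_taylor_four hr hφ hφ0 hDφ0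
  obtain ⟨R, hR, C, hC, hRC⟩ := exists_sum_norm_iteratedFDeriv_le
    (f := invertedGraphRem φ (Metric.ball 0 ρ₀)) fun x₀ hx₀ =>
      exists_invertedGraphRem_eq hρ₀ hinj hT
        (fun z hz => hφT z (Metric.ball_subset_ball hρ₀r hz)) hx₀
  set ρ : ℝ := min ρ₀ (2 * R)⁻¹
  have hρ : 0 < ρ := lt_min hρ₀ (by positivity)
  have hball : Metric.ball (0 : EuclideanSpace ℝ (Fin 4)) ρ ⊆ Metric.ball 0 ρ₀ :=
    Metric.ball_subset_ball (min_le_left _ _)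
  set V := graphInv φ '' Metric.ball 0 ρ
  have hV : IsOpen V := hopen ρ (min_le_left _ _)
  have hV0 : V ∈ nhds 0 :=
    hV.mem_nhds ⟨0, Metric.mem_ball_self hρ, by simp [graphInv]⟩
  obtain ⟨ε, hε, hεV⟩ := Metric.mem_nhds_iff.1 hV0
  set U : Set (EuclideanSpace ℝ (Fin 4)) := {ζ | ζ ≠ 0 ∧ (‖ζ‖ ^ 2)⁻¹ • ζ ∈ V}
  have hnorm : ∀ ζ : EuclideanSpace ℝ (Fin 4), ζ ≠ 0 → ‖(‖ζ‖ ^ 2)⁻¹ • ζ‖ = ‖ζ‖⁻¹ :=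
    fun ζ hζ => by
      have := norm_pos_iff.2 hζ
      rw [norm_smul, Real.norm_of_nonneg (by positivity)]
      field_simp
  have hUR : ∀ ζ ∈ U, R < ‖ζ‖ := by
    rintro ζ ⟨hζ, z, hz, hzζ⟩
    have h1 := hle z (hball hz)
    rw [hzζ, hnorm ζ hζ] at h1
    have h2 : ‖z‖ < (2 * R)⁻¹ := (mem_ball_zero_iff.1 hz).trans_le (min_le_right _ _)
    rw [mul_inv] at h2
    exact (inv_lt_inv₀ (norm_pos_iff.2 hζ) hR).1 (by linarith)
  refine ⟨ρ, hρ, (min_le_left _ _).trans hρ₀r, ε⁻¹, by positivity, C, hC, U, ?_, ?_,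
    invertedGraph φ (Metric.ball 0 ρ₀), ?_, inversion_image_graph hinj hball,
    invertedGraphRem φ (Metric.ball 0 ρ₀), ?_, fun ζ hζ => (hRC ζ (hUR ζ hζ)).2⟩
  · have hc : ContinuousOn (fun ζ : EuclideanSpace ℝ (Fin 4) => (‖ζ‖ ^ 2)⁻¹ • ζ) {0}ᶜ :=
      ((continuous_norm.pow 2).continuousOn.inv₀ fun ζ hζ => by simpa using hζ).smul
        continuousOn_id
    exact hc.isOpen_inter_preimage isOpen_compl_singleton hV
  · intro ζ hζ
    have hζ0 : ζ ≠ 0 := norm_pos_iff.1 ((inv_pos.2 hε).trans hζ)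
    refine ⟨hζ0, hεV (mem_ball_zero_iff.2 ?_)⟩
    rw [hnorm ζ hζ0]
    exact inv_lt_of_inv_lt₀ hε hζ
  · exact fun ζ hζ => (contDiffAt_invertedGraph hζ.1 (hRC ζ (hUR ζ hζ)).1).contDiffWithinAt
  · intro ζ _
    have h2 : ![‖ζ‖⁻¹ • ζ, ‖ζ‖⁻¹ • ζ] = fun _ => ‖ζ‖⁻¹ • ζ := by
      funext i; fin_cases i <;> rfl
    have h3 : ![‖ζ‖⁻¹ • ζ, ‖ζ‖⁻¹ • ζ, ‖ζ‖⁻¹ • ζ] = fun _ => ‖ζ‖⁻¹ • ζ := by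
      funext i; fin_cases i <;> rfl
    rw [h3, h2, invertedGraphRem]
    abel
end
end
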